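/- Let N be a positive integer, w ∈ S∞, φ a flag, and r^• ∈ RFC(w,φ). Then P̂(shift_N(r^•)) is obtained from P̂(r^•) by shifting all boxes up by N rows and adding N to every entry, and Q̂(shift_N(r^•)) is obtained from Q̂(r^•) by shifting all boxes up by N rows, where shift_N adds N to each letter of every block (producing an element of RFC(1_N × w, φ), with 1_N × w ∈ S∞ the permutation fixing 1,…,N and sending i+N to w(i)+N). -/

import Mathlib

noncomputable section
attribute [local instance] Classical.propDecidable

/-! ### Words, permutations, reduced words -/

/-- The adjacent transposition `s_i` exchanging `i` and `i+1`. -/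
def sPerm (i : ℕ) : Equiv.Perm ℕ := Equiv.swap i (i + 1)

/-- The permutation `s_{i_1} ⋯ s_{i_n}` represented by the word `i_1 ⋯ i_n`. -/
def wordPerm (ρ : List ℕ) : Equiv.Perm ℕ := (ρ.map sPerm).prod

/-- A word whose letters are positive integers. -/
def PosWord (ρ : List ℕ) : Prop := ∀ x ∈ ρ, 1 ≤ x

/-- A reduced word: a word of positive integers of minimal length among all words of
positive integers representing the same permutation. -/
def IsReducedWord (ρ : List ℕ) : Prop :=
  PosWord ρ ∧ ∀ σ : List ℕ, PosWord σ → wordPerm σ = wordPerm ρ → ρ.length ≤ σ.length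

/-- `ρ` is a reduced word for the permutation `w`. -/
def IsReducedWordFor (w : Equiv.Perm ℕ) (ρ : List ℕ) : Prop :=
  IsReducedWord ρ ∧ wordPerm ρ = w

/-- A member of `S∞`: a permutation of the positive integers (it fixes `0`)
fixing all but finitely many points. -/
def FinitaryPerm (w : Equiv.Perm ℕ) : Prop := w 0 = 0 ∧ {i : ℕ | w i ≠ i}.Finite

/-- A flag: a weakly increasing function `φ : ℤ_{>0} → ℤ_{>0}` with `φ(n) ≥ n`. -/
def IsFlag (φ : ℕ → ℕ) : Prop :=
  (∀ m n : ℕ, 1 ≤ m → m ≤ n → φ m ≤ φ n) ∧ ∀ n : ℕ, 1 ≤ n → n ≤ φ n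

/-- A weak composition, as a function on the positive integers (value `0` at `0`)
with finitely many nonzero entries. -/
def WeakComp (α : ℕ → ℕ) : Prop := α 0 = 0 ∧ {i : ℕ | α i ≠ 0}.Finite

/-- `φ - e_i`, i.e. `l ↦ φ(l) - δ_{il}`. -/
def subE (φ : ℕ → ℕ) (i : ℕ) : ℕ → ℕ := fun l => if l = i then φ l - 1 else φ l

/-- The right action of `s_i` on weak compositions, swapping entries `i` and `i+1`. -/
def swapC (α : ℕ → ℕ) (i : ℕ) : ℕ → ℕ := fun j => α (sPerm i j)

/-- `α` has length `k`: `k` is minimal with `α i = 0` for all `i > k`. -/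
def HasLen (α : ℕ → ℕ) (k : ℕ) : Prop :=
  (∀ i, k < i → α i = 0) ∧ ∀ m, (∀ i, m < i → α i = 0) → k ≤ m

/-! ### Coxeter–Knuth equivalence -/

/-- One Coxeter–Knuth move. -/
def CKStep (u v : List ℕ) : Prop :=
  (∃ (a b : List ℕ) (x y z : ℕ), y < x ∧ x < z ∧
      u = a ++ [x, y, z] ++ b ∧ v = a ++ [x, z, y] ++ b) ∨
  (∃ (a b : List ℕ) (x y z : ℕ), y < z ∧ z < x ∧
      u = a ++ [x, y, z] ++ b ∧ v = a ++ [y, x, z] ++ b) ∨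
  (∃ (a b : List ℕ) (i : ℕ),
      u = a ++ [i, i + 1, i] ++ b ∧ v = a ++ [i + 1, i, i + 1] ++ b)

/-- Coxeter–Knuth equivalence: the transitive (symmetric, reflexive) closure of `CKStep`. -/
def CKEquiv : List ℕ → List ℕ → Prop := Relation.EqvGen CKStep

/-! ### Run factorizations and weak descent tableaux -/

/-- The run factorization of a word into maximal strictly increasing blocks
(listed from left to right). -/
def runFact : List ℕ → List (List ℕ)
  | [] => []
  | a :: rest =>
    match runFact rest with
    | [] => [[a]]
    | r :: rs => if a < r.headI then (a :: r) :: rs else [a] :: r :: rs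

/-- Auxiliary: rows of the remaining blocks, given the row of the previous block. -/
def wdtRowsAux : ℤ → List (List ℕ) → List ℤ
  | _, [] => []
  | prev, b :: bs =>
      min (prev - 1) (b.headI : ℤ) :: wdtRowsAux (min (prev - 1) (b.headI : ℤ)) bs

/-- The row indices assigned to the blocks of a run factorization (blocks listed
left to right): the leftmost block goes to the row indexed by its first letter, and each
subsequent block goes to the row indexed by its first letter if this is below the previous
block's row, and otherwise directly below the previous block's row. -/
def wdtRows : List (List ℕ) → List ℤ
  | [] => []
  | b :: bs => (b.headI : ℤ) :: wdtRowsAux (b.headI : ℤ) bs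

/-- A tableau: rows indexed by `ℤ` (bottom to top), columns indexed by `ℕ` starting at `1`;
the value `0` means that there is no box, a nonzero value is the (positive) entry. -/
abbrev Tableau := ℤ → ℕ → ℕ

/-- The weak descent tableau of a word. -/
def weakDesTab (ρ : List ℕ) : Tableau := fun r c =>
  if c = 0 then 0
  else
    match ((wdtRows (runFact ρ)).zip (runFact ρ)).find? (fun p => decide (p.1 = r)) with
    | some p => p.2.getD (c - 1) 0
    | none => 0

/-- A word is non-virtual if its weak descent tableau only occupies rows of positive index. -/
def NonVirtual (ρ : List ℕ) : Prop := ∀ r ∈ wdtRows (runFact ρ), 1 ≤ r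

/-- The shape of a tableau: the number of boxes in each (positively indexed) row. -/
def shapeOf (T : Tableau) : ℕ → ℕ := fun i => Set.ncard {c : ℕ | T (i : ℤ) c ≠ 0}

/-- The weak descent composition of a word: the shape of its weak descent tableau. -/
def desComp (ρ : List ℕ) : ℕ → ℕ := shapeOf (weakDesTab ρ)

/-- Partial-sum (dominance) order on weak compositions. -/
def compLE (μ ν : ℕ → ℕ) : Prop :=
  ∀ k : ℕ, ∑ i ∈ Finset.Icc 1 k, μ i ≤ ∑ i ∈ Finset.Icc 1 k, ν i

/-- A Yamanouchi reduced word: a non-virtual reduced word that is minimal in its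
Coxeter–Knuth class among non-virtual words, for the order
`ρ ≤ τ ↔ ρ ~ τ ∧ des ρ ≤ des τ`. -/
def Yamanouchi (ρ : List ℕ) : Prop :=
  IsReducedWord ρ ∧ NonVirtual ρ ∧
    ∀ σ : List ℕ, NonVirtual σ → CKEquiv ρ σ → compLE (desComp ρ) (desComp σ)

/-- The (unique) Yamanouchi reduced word Coxeter–Knuth equivalent to `ρ`. -/
def hatRho (ρ : List ℕ) : List ℕ :=
  if h : ∃ σ, Yamanouchi σ ∧ CKEquiv ρ σ then h.choose else []

/-- The weak Edelman–Greene insertion tableau of a word: the weak descent tableau of the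
unique Yamanouchi reduced word Coxeter–Knuth equivalent to it. -/
def hatP (ρ : List ℕ) : Tableau := weakDesTab (hatRho ρ)

/-! ### Factorizations -/

/-- The factorization `f : ℕ → List ℕ` stores the block `ρ^{(i)}` at index `i ≥ 1`
(blocks indexed from the right); the largest index of a nonempty block. -/
def topIdx (f : ℕ → List ℕ) : ℕ := sSup {i : ℕ | f i ≠ []}

/-- The concatenation `ρ^{(top)} ⋯ ρ^{(i+1)} ρ^{(i)}` of the blocks of `f` with index `≥ i`. -/
def factWordGe (f : ℕ → List ℕ) (i : ℕ) : List ℕ :=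
  ((((List.range (topIdx f + 1)).reverse).filter (fun j => decide (i ≤ j))).map f).foldr
    (· ++ ·) []

/-- The underlying word of a factorization. -/
def factWord (f : ℕ → List ℕ) : List ℕ := factWordGe f 0

/-- The weak Edelman–Greene recording tableau of a factorization: it has the same shape as
the weak EG insertion tableau of the underlying word, and has entry `i` in all boxes of
`P̂(ρ^{(k)}|⋯|ρ^{(i)})` that are not in `P̂(ρ^{(k)}|⋯|ρ^{(i+1)})`. -/
def hatQfact (f : ℕ → List ℕ) : Tableau := fun r c =>
  sSup {i : ℕ | 1 ≤ i ∧ hatP (factWordGe f i) r c ≠ 0 ∧ hatP (factWordGe f (i + 1)) r c = 0}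

/-- Every block is strictly increasing. -/
def IncreasingFact (f : ℕ → List ℕ) : Prop := ∀ i, List.Chain' (· < ·) (f i)

/-- The factorization is `φ`-flagged: every nonempty block `ρ^{(i)}` has first letter
`ρ^{(i)}_1` with `φ(ρ^{(i)}_1) ≥ i`. -/
def FlaggedFact (φ : ℕ → ℕ) (f : ℕ → List ℕ) : Prop :=
  ∀ i, f i ≠ [] → i ≤ φ ((f i).headI)

/-- `RFC(w, φ)`: all `φ`-flagged increasing factorizations of reduced words for `w`. -/
def RFCset (w : Equiv.Perm ℕ) (φ : ℕ → ℕ) : Set (ℕ → List ℕ) :=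
  {f | f 0 = [] ∧ {i : ℕ | f i ≠ []}.Finite ∧ IncreasingFact f ∧ FlaggedFact φ f ∧
       IsReducedWordFor w (factWord f)}

/-- `RF_n(w)`: increasing factorizations of reduced words for `w` with exactly `n` blocks
(indexed `1, …, n`, possibly empty). -/
def RFn (n : ℕ) (w : Equiv.Perm ℕ) : Set (ℕ → List ℕ) :=
  {f | f 0 = [] ∧ (∀ j, n < j → f j = []) ∧ IncreasingFact f ∧
       IsReducedWordFor w (factWord f)}

/-- `RFC_n(w, φ)`: the `φ`-flagged elements of `RF_n(w)`. -/
def RFCn (n : ℕ) (w : Equiv.Perm ℕ) (φ : ℕ → ℕ) : Set (ℕ → List ℕ) :=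
  {f | f ∈ RFn n w ∧ FlaggedFact φ f}

/-! ### Morse–Schilling crystal operators -/

/-- Pairing procedure: first argument is the block `r^{(i)}` in *decreasing* order, second is
the not-yet-paired part of the block `r^{(i+1)}` (in increasing order). Each letter `b` of
`r^{(i)}`, from largest to smallest, is paired with the smallest still unpaired letter of
`r^{(i+1)}` strictly larger than `b`. Returns the unpaired letters of `r^{(i+1)}`. -/
def unpairedUpper : List ℕ → List ℕ → List ℕ
  | [], A => A
  | b :: bs, A =>
    match A.find? (fun a => decide (b < a)) with
    | some a => unpairedUpper bs (A.erase a)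
    | none => unpairedUpper bs A

/-- As in `unpairedUpper`, but returns the unpaired letters of `r^{(i)}`. -/
def unpairedLower : List ℕ → List ℕ → List ℕ
  | [], _ => []
  | b :: bs, A =>
    match A.find? (fun a => decide (b < a)) with
    | some a => unpairedLower bs (A.erase a)
    | none => b :: unpairedLower bs A

/-- Insert a letter into a weakly increasing list, keeping it increasing. -/
def insAsc (x : ℕ) : List ℕ → List ℕ
  | [] => [x]
  | y :: ys => if x ≤ y then x :: y :: ys else y :: insAsc x ys

/-- The Morse–Schilling raising operator `e_i`: if every letter of block `i+1` is paired,
the result is `none` (i.e. `0`); otherwise the largest unpaired letter `a` of block `i+1` is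
removed and `a + s` is added to block `i`, where `s = min {j ≥ 0 | a+j+1 ∉ r^{(i+1)}}`. -/
def msE (i : ℕ) (f : ℕ → List ℕ) : Option (ℕ → List ℕ) :=
  let B := f i
  let A := f (i + 1)
  let L := unpairedUpper B.reverse A
  if L = [] then none
  else
    let a := L.foldr max 0
    let s := sInf {j : ℕ | (a + j + 1) ∉ A}
    some (Function.update (Function.update f (i + 1) (A.erase a)) i (insAsc (a + s) B))

/-- The Morse–Schilling lowering operator `f_i`: if every letter of block `i` is paired,
the result is `none`; otherwise the smallest unpaired letter `b` of block `i` is removed and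
`b - t` is added to block `i+1`, where `t = min {j ≥ 0 | b-j-1 ∉ r^{(i)}}`. -/
def msF (i : ℕ) (f : ℕ → List ℕ) : Option (ℕ → List ℕ) :=
  let B := f i
  let A := f (i + 1)
  let R := unpairedLower B.reverse A
  if R = [] then none
  else
    let b := R.foldr min R.headI
    let t := sInf {j : ℕ | (b - j - 1) ∉ B}
    some (Function.update (Function.update f i (B.erase b)) (i + 1) (insAsc (b - t) A))

/-- Iteration `e_j^k` of the raising operator. -/
def msEIter (j : ℕ) : ℕ → (ℕ → List ℕ) → Option (ℕ → List ℕ)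
  | 0, f => some f
  | k + 1, f => (msE j f).bind (msEIter j k)

/-- The Demazure operator `𝔇_j` on subsets of the crystal `RF_n(w)`:
`𝔇_j X = {b ∈ RF_n(w) | e_j^k(b) ∈ X for some k ≥ 0}`. -/
def demOp (n : ℕ) (w : Equiv.Perm ℕ) (j : ℕ) (X : Set (ℕ → List ℕ)) : Set (ℕ → List ℕ) :=
  {b | b ∈ RFn n w ∧ ∃ (k : ℕ) (c : ℕ → List ℕ), msEIter j k b = some c ∧ c ∈ X}

/-- `𝔇_{i_1} 𝔇_{i_2} ⋯ 𝔇_{i_k} X` for a word `i_1 i_2 ⋯ i_k` (the head is applied last). -/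
def demWord (n : ℕ) (w : Equiv.Perm ℕ) : List ℕ → Set (ℕ → List ℕ) → Set (ℕ → List ℕ)
  | [], X => X
  | j :: rest, X => demOp n w j (demWord n w rest X)

/-- `𝔇_{b↓a} = 𝔇_{b-1} 𝔇_{b-2} ⋯ 𝔇_a` (the identity when `b ≤ a`). -/
def demDown (n : ℕ) (w : Equiv.Perm ℕ) (b a : ℕ) (X : Set (ℕ → List ℕ)) :
    Set (ℕ → List ℕ) :=
  demWord n w ((List.range' a (b - a)).reverse) X

/-! ### Key tableaux -/

/-- A key tableau: a filling of a left-justified diagram in the positively indexed rows,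
with positive entries, weakly decreasing rows, distinct column entries, and the key
condition (c) of Assaf–Schilling. -/
def IsKeyTableau (T : Tableau) : Prop :=
  (∀ (r : ℤ) (c : ℕ), r ≤ 0 → T r c = 0) ∧
  (∀ r : ℤ, T r 0 = 0) ∧
  {p : ℤ × ℕ | T p.1 p.2 ≠ 0}.Finite ∧
  (∀ (r : ℤ) (c : ℕ), 1 ≤ c → T r (c + 1) ≠ 0 → T r c ≠ 0) ∧
  (∀ (r : ℤ) (c : ℕ), 1 ≤ c → T r (c + 1) ≠ 0 → T r (c + 1) ≤ T r c) ∧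
  (∀ (r r' : ℤ) (c : ℕ), r ≠ r' → T r c ≠ 0 → T r' c ≠ 0 → T r c ≠ T r' c) ∧
  (∀ (r r' : ℤ) (c : ℕ), r < r' → T r c ≠ 0 → T r' c ≠ 0 → T r' c < T r c →
      T r (c + 1) ≠ 0 ∧ T r' c < T r (c + 1))

/-- The tableau is `φ`-flagged: every entry in row `i` is at most `φ(i)`. -/
def FlaggedTab (φ : ℕ → ℕ) (T : Tableau) : Prop := ∀ (i c : ℕ), T (i : ℤ) c ≤ φ i

/-- `SSKT(α, φ)`: the `φ`-flagged key tableaux of shape `α`. -/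
def SSKT (α φ : ℕ → ℕ) : Set Tableau :=
  {T | IsKeyTableau T ∧ shapeOf T = α ∧ FlaggedTab φ T}

/-- The weight of a tableau: `wt(T)_v` is the number of entries equal to `v`. -/
def wtTab (T : Tableau) : ℕ → ℕ := fun v =>
  if v = 0 then 0 else Set.ncard {p : ℤ × ℕ | T p.1 p.2 = v}

/-- The weight of a word: the multiplicity of each positive letter. -/
def wtWord (u : List ℕ) : ℕ → ℕ := fun v => if v = 0 then 0 else u.count v

/-- The statistic `m_i(col(T), j)` where position `j` of the reverse column reading word
(entries read down columns, from right to left) is the box in row `r`, column `c`: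
the number of entries `i+1` weakly after this box minus the number of entries `i`. -/
def mi (T : Tableau) (i : ℕ) (r : ℤ) (c : ℕ) : ℤ :=
  (Set.ncard {p : ℤ × ℕ | T p.1 p.2 = i + 1 ∧ (p.2 < c ∨ (p.2 = c ∧ p.1 ≤ r))} : ℤ) -
  (Set.ncard {p : ℤ × ℕ | T p.1 p.2 = i ∧ (p.2 < c ∨ (p.2 = c ∧ p.1 ≤ r))} : ℤ)

/-- The box `(r, c)` maximizes `m_i` among all boxes of `T`. -/
def isMaxBox (T : Tableau) (i : ℕ) (r : ℤ) (c : ℕ) : Prop :=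
  T r c ≠ 0 ∧ ∀ (r' : ℤ) (c' : ℕ), T r' c' ≠ 0 → mi T i r' c' ≤ mi T i r c

/-- The Assaf–Schilling raising operator `e_i` on key tableaux.  If `m_i(col(T)) ≤ 0` the
result is `none` (i.e. `0`); otherwise, with `q` the largest position of the reverse column
reading word achieving the maximum (i.e. the maximizing box with the smallest column index,
and the smallest row index in that column), all entries `i+1` in the row of `q` weakly to its
right are changed to `i`, and all entries `i` in the same columns as these entries are
changed to `i+1`. -/
def keyE (i : ℕ) (T : Tableau) : Option Tableau :=
  if h : ∃ (r : ℤ) (c : ℕ), isMaxBox T i r c ∧ 1 ≤ mi T i r c then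
    let cq := sInf {c : ℕ | ∃ r : ℤ, isMaxBox T i r c}
    let rq : ℤ := ((sInf {m : ℕ | isMaxBox T i ((m : ℕ) : ℤ) cq} : ℕ) : ℤ)
    some (fun r c =>
      if cq ≤ c ∧ T rq c = i + 1 then
        (if T r c = i + 1 then i else if T r c = i then i + 1 else T r c)
      else T r c)
  else none

/-- The Assaf–Schilling lowering operator `f_i`: the (unique) inverse of `e_i`. -/
def keyF (i : ℕ) (T : Tableau) : Option Tableau :=
  if h : ∃ T', keyE i T' = some T then some h.choose else none

/-- Restriction of a partially defined crystal operator to a subset: the operator returns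
`none` (i.e. `0`) whenever it would leave the subset. -/
def restrictOp {β : Type} (S : Set β) (op : β → Option β) (x : β) : Option β :=
  (op x).bind fun y => if y ∈ S then some y else none

/-! ### Polynomials: divided differences and key polynomials -/

/-- The divided difference operator `∂_i f = (f - s_i · f) / (x_i - x_{i+1})`. -/
def divDiff (i : ℕ) (fp : MvPolynomial ℕ ℤ) : MvPolynomial ℕ ℤ :=
  if h : ∃ g : MvPolynomial ℕ ℤ,
      g * (MvPolynomial.X i - MvPolynomial.X (i + 1)) =
        fp - MvPolynomial.rename (fun j => sPerm i j) fp
  then h.choose else 0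

/-- The isobaric divided difference operator `π_i f = ∂_i (x_i f)`. -/
def piOp (i : ℕ) (fp : MvPolynomial ℕ ℤ) : MvPolynomial ℕ ℤ :=
  divDiff i (MvPolynomial.X i * fp)

/-- `π_{i_1} π_{i_2} ⋯ π_{i_k} f` for a word `i_1 i_2 ⋯ i_k` (the head is applied last). -/
def piWord : List ℕ → MvPolynomial ℕ ℤ → MvPolynomial ℕ ℤ
  | [], fp => fp
  | i :: rest, fp => piOp i (piWord rest fp)

/-- `π_{b↓a} = π_{b-1} π_{b-2} ⋯ π_a` (the identity when `b ≤ a`). -/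
def piDown (b a : ℕ) (fp : MvPolynomial ℕ ℤ) : MvPolynomial ℕ ℤ :=
  piWord ((List.range' a (b - a)).reverse) fp

/-- The conjugate of a weak composition: `conjC α t = #{j ≥ 1 | α_j ≥ t}` for `t ≥ 1`. -/
def conjC (α : ℕ → ℕ) (t : ℕ) : ℕ :=
  Set.ncard {j : ℕ | 1 ≤ j ∧ 1 ≤ t ∧ t ≤ α j}

/-- The partition rearrangement of a weak composition (the conjugate of its conjugate). -/
def sortC (α : ℕ → ℕ) : ℕ → ℕ := conjC (conjC α)

/-- The length of a permutation: the common length of its reduced words. -/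
def permLength (w : Equiv.Perm ℕ) : ℕ :=
  sInf {n : ℕ | ∃ ρ : List ℕ, PosWord ρ ∧ wordPerm ρ = w ∧ ρ.length = n}

/-- The monomial `x^β = x_1^{β_1} x_2^{β_2} ⋯`. -/
def xExp (β : ℕ → ℕ) : MvPolynomial ℕ ℤ :=
  ∏ i ∈ Finset.range (sSup {n : ℕ | β n ≠ 0} + 1), MvPolynomial.X i ^ β i

/-- The key polynomial `κ_α = π_w x^λ` where `λ` is the partition rearrangement of `α` and
`w` is the minimal-length permutation of `S∞` with `α · w = λ`. -/
def keyPoly (α : ℕ → ℕ) : MvPolynomial ℕ ℤ :=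
  if h : ∃ (ρ : List ℕ) (w : Equiv.Perm ℕ), IsReducedWordFor w ρ ∧
      (∀ i, α (w i) = sortC α i) ∧
      (∀ v : Equiv.Perm ℕ, (∃ τ, IsReducedWordFor v τ) → (∀ i, α (v i) = sortC α i) →
        permLength w ≤ permLength v)
  then piWord h.choose (xExp (sortC α)) else 0

/-- The `φ`-flagged key polynomial `κ_{(α,φ)} = Σ_{T ∈ SSKT(α,φ)} x^{wt(T)}`. -/
def flaggedKeyPoly (α φ : ℕ → ℕ) : MvPolynomial ℕ ℤ :=
  ∑ᶠ T ∈ SSKT α φ, xExp (wtTab T)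

/-! ### Column insertion, keys, standardization -/

/-- The number of boxes in column `c` of a tableau. -/
def colHeightN (T : Tableau) (c : ℕ) : ℕ := Set.ncard {r : ℤ | T r c ≠ 0}

/-- One pass of column insertion: insert the value `x` starting at column `c`
(`fuel` bounds the number of columns visited). -/
def colInsertAux : ℕ → Tableau → ℕ → ℕ → Tableau
  | 0, T, _, _ => T
  | fuel + 1, T, c, x =>
    if ∀ r : ℤ, T r c ≠ 0 → T r c < x then
      -- x is greater than every entry of column c: place it at the end of the column
      fun r c' => if c' = c ∧ r = (colHeightN T c + 1 : ℤ) then x else T r c'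
    else if ∃ r : ℤ, T r c = x then
      -- column c contains x: move on to the next column with the same value
      colInsertAux fuel T (c + 1) x
    else
      -- bump the smallest entry of column c that is larger than x
      let y := sInf {v : ℕ | x < v ∧ ∃ r : ℤ, T r c = v}
      colInsertAux fuel (fun r c' => if c' = c ∧ T r c' = y then x else T r c') (c + 1) y

/-- Column insertion of `x` into the semistandard Young tableau `T`. -/
def colInsert (T : Tableau) (x : ℕ) : Tableau :=
  colInsertAux (sSup {c : ℕ | ∃ r : ℤ, T r c ≠ 0} + 2) T 1 x

/-- The insertion tableau `P` of `(v → ∅)`: successively column insert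
`v_n, v_{n-1}, …, v_1` into the empty tableau. -/
def insertP (v : List ℕ) : Tableau :=
  v.reverse.foldl colInsert (fun _ _ => 0)

/-- The recording tableau `Q` of `(v → ∅)`: the standard Young tableau whose restriction to
`{1, …, j}` has the same shape as the insertion tableau of the last `j` letters of `v`. -/
def insertQ (v : List ℕ) : Tableau := fun r c =>
  sInf {j : ℕ | insertP (v.drop (v.length - j)) r c ≠ 0}

/-- The key `key(α)`: the unique semistandard Young tableau of weight `α` such that the set
of entries of column `i+1` is a subset of the entries of column `i`; its column `c` consists
of the elements of `{x ≥ 1 | α_x ≥ c}` in increasing order from bottom to top. -/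
def keyTab (α : ℕ → ℕ) : Tableau := fun r c =>
  if c = 0 then 0
  else sInf {x : ℕ | 1 ≤ x ∧ c ≤ α x ∧
    ((Set.ncard {y : ℕ | 1 ≤ y ∧ c ≤ α y ∧ y ≤ x} : ℕ) : ℤ) = r}

/-- The standardization of a semistandard Young tableau: the `1`'s are replaced from left to
right by `1, …, β_1`, the `2`'s by `β_1 + 1, …, β_1 + β_2`, and so on. -/
def stdTab (T : Tableau) : Tableau := fun r c =>
  if T r c = 0 then 0
  else Set.ncard {p : ℤ × ℕ |
    T p.1 p.2 ≠ 0 ∧ (T p.1 p.2 < T r c ∨ (T p.1 p.2 = T r c ∧ p.2 ≤ c))}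

/-! ### Maximal factorizations (Reiner–Shimozono) -/

/-- Every block is weakly increasing. -/
def WeaklyIncrFact (g : ℕ → List ℕ) : Prop := ∀ i, List.Chain' (· ≤ ·) (g i)

/-- Maximality: the nonempty blocks have maximal length, i.e. there is a strict descent
between any two consecutive nonempty blocks (no letter can be moved from the end of a block
to the front of the next one to the right). -/
def MaxFact (g : ℕ → List ℕ) : Prop :=
  ∀ i j : ℕ, 1 ≤ i → i < j → g i ≠ [] → g j ≠ [] → (∀ m, i < m → m < j → g m = []) →
    (g i).headI < (g j).getLastD 0

/-- Reiner–Shimozono's set `𝒲(α, φ)` of `φ`-flagged maximal factorizations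
`u^• = u^n ⋯ u^2 u^1` with `ℓ(u^i) = α_i` and `(u → ∅) = (P, std(key(α)))`. -/
def Wset (α φ : ℕ → ℕ) : Set (ℕ → List ℕ) :=
  {g | g 0 = [] ∧ (∀ i, (g i).length = α i) ∧ (∀ i, ∀ x ∈ g i, 1 ≤ x) ∧
       WeaklyIncrFact g ∧ MaxFact g ∧ (∀ i, ∀ x ∈ g i, x ≤ φ i) ∧
       insertQ (factWord g) = stdTab (keyTab α)}

/-! ### Shifts and highest weight key tableaux -/

/-- `shift_N`: add `N` to every letter of every block. -/
def shiftFact (N : ℕ) (f : ℕ → List ℕ) : ℕ → List ℕ := fun i => (f i).map (· + N)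

/-- The tableau of shape `α` whose column `i` is filled by `1, 2, …, λ^T_i` in increasing
order from bottom to top (where `λ^T` is the conjugate of the partition rearrangement `λ`
of `α`): the box of column `c` in row `m` (where `α_m ≥ c`) contains the number of indices
`m' ≤ m` with `α_{m'} ≥ c`. -/
def highKeyTab (α : ℕ → ℕ) : Tableau := fun r c =>
  if c = 0 then 0
  else if ∃ m : ℕ, (m : ℤ) = r ∧ 1 ≤ m ∧ c ≤ α m then
    Set.ncard {m : ℕ | 1 ≤ m ∧ c ≤ α m ∧ (m : ℤ) ≤ r}
  else 0


/-- A `gl_n`-crystal isomorphism between two sets of key tableaux, both equipped with the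
Assaf–Schilling operators (restricted to the sets): a weight-preserving bijection commuting
with all raising and lowering operators `e_i, f_i` for `1 ≤ i < n`. -/
def SSKTIso (n : ℕ) (S₁ S₂ : Set Tableau) : Prop :=
  ∃ g : Tableau → Tableau, Set.BijOn g S₁ S₂ ∧
    (∀ T ∈ S₁, wtTab T = wtTab (g T)) ∧
    ∀ T ∈ S₁, ∀ i : ℕ, 1 ≤ i → i < n →
      Option.map g (restrictOp S₁ (keyE i) T) = restrictOp S₂ (keyE i) (g T) ∧
      Option.map g (restrictOp S₁ (keyF i) T) = restrictOp S₂ (keyF i) (g T)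

theorem sPerm_mul_self (i : ℕ) : sPerm i * sPerm i = 1 := Equiv.swap_mul_self _ _

theorem sPerm_comm {i j : ℕ} (h : i + 2 ≤ j) : sPerm i * sPerm j = sPerm j * sPerm i := by
  ext x
  simp only [sPerm, Equiv.Perm.mul_apply, Equiv.swap_apply_def]
  split_ifs <;> omega

theorem sPerm_comm_of_far {i j : ℕ} (h : i + 2 ≤ j ∨ j + 2 ≤ i) :
    sPerm i * sPerm j = sPerm j * sPerm i := by
  rcases h with h | h
  · exact sPerm_comm h
  · exact (sPerm_comm h).symm

theorem sPerm_braid (i : ℕ) :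
    sPerm i * sPerm (i + 1) * sPerm i = sPerm (i + 1) * sPerm i * sPerm (i + 1) := by
  ext x
  simp only [sPerm, Equiv.Perm.mul_apply, Equiv.swap_apply_def]
  split_ifs <;> omega

@[simp] theorem wordPerm_nil : wordPerm [] = 1 := rfl

@[simp] theorem wordPerm_cons (i : ℕ) (ρ : List ℕ) :
    wordPerm (i :: ρ) = sPerm i * wordPerm ρ := by simp [wordPerm]

@[simp] theorem wordPerm_append (ρ σ : List ℕ) :
    wordPerm (ρ ++ σ) = wordPerm ρ * wordPerm σ := by simp [wordPerm]

theorem PosWord.append {u v : List ℕ} (hu : PosWord u) (hv : PosWord v) : PosWord (u ++ v) := by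
  intro x hx
  rcases List.mem_append.1 hx with h | h
  · exact hu x h
  · exact hv x h

theorem PosWord.left {u v : List ℕ} (h : PosWord (u ++ v)) : PosWord u :=
  fun x hx => h x (List.mem_append_left _ hx)

theorem PosWord.right {u v : List ℕ} (h : PosWord (u ++ v)) : PosWord v :=
  fun x hx => h x (List.mem_append_right _ hx)

/-! ### Coxeter–Knuth moves -/

theorem CKStep.append (a b : List ℕ) {u v : List ℕ} (h : CKStep u v) :
    CKStep (a ++ u ++ b) (a ++ v ++ b) := by
  rcases h with ⟨c, d, x, y, z, h1, h2, rfl, rfl⟩ | ⟨c, d, x, y, z, h1, h2, rfl, rfl⟩ |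
    ⟨c, d, i, rfl, rfl⟩
  · exact Or.inl ⟨a ++ c, d ++ b, x, y, z, h1, h2, by simp, by simp⟩
  · exact Or.inr (Or.inl ⟨a ++ c, d ++ b, x, y, z, h1, h2, by simp, by simp⟩)
  · exact Or.inr (Or.inr ⟨a ++ c, d ++ b, i, by simp, by simp⟩)

theorem CKEquiv.refl (u : List ℕ) : CKEquiv u u := Relation.EqvGen.refl u

theorem CKEquiv.of_eq {u v : List ℕ} (h : u = v) : CKEquiv u v := h ▸ CKEquiv.refl u

theorem CKEquiv.symm {u v : List ℕ} (h : CKEquiv u v) : CKEquiv v u :=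
  Relation.EqvGen.symm _ _ h

theorem CKEquiv.trans {u v w : List ℕ} (h : CKEquiv u v) (h' : CKEquiv v w) : CKEquiv u w :=
  Relation.EqvGen.trans _ _ _ h h'

instance : Trans CKEquiv CKEquiv CKEquiv := ⟨CKEquiv.trans⟩

theorem CKEquiv.append_append (a b : List ℕ) {u v : List ℕ} (h : CKEquiv u v) :
    CKEquiv (a ++ u ++ b) (a ++ v ++ b) := by
  induction h with
  | rel x y h => exact Relation.EqvGen.rel _ _ (h.append a b)
  | refl x => exact CKEquiv.refl _
  | symm x y _ ih => exact ih.symm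
  | trans x y z _ _ ih ih' => exact ih.trans ih'

theorem CKEquiv.append_left (a : List ℕ) {u v : List ℕ} (h : CKEquiv u v) :
    CKEquiv (a ++ u) (a ++ v) := by
  simpa using h.append_append a []

theorem CKEquiv.append_right {u v : List ℕ} (h : CKEquiv u v) (b : List ℕ) :
    CKEquiv (u ++ b) (v ++ b) := by
  simpa using h.append_append [] b

theorem CKEquiv.cons (a : ℕ) {u v : List ℕ} (h : CKEquiv u v) :
    CKEquiv (a :: u) (a :: v) := h.append_left [a]

theorem CKEquiv.append {u v u' v' : List ℕ} (h : CKEquiv u v) (h' : CKEquiv u' v') :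
    CKEquiv (u ++ u') (v ++ v') := (h.append_right u').trans (h'.append_left v)

theorem ckEquiv_mid_low_high {x y z : ℕ} (h : y < x) (h' : x < z) (t : List ℕ) :
    CKEquiv (x :: y :: z :: t) (x :: z :: y :: t) :=
  Relation.EqvGen.rel _ _ (Or.inl ⟨[], t, x, y, z, h, h', by simp, by simp⟩)

theorem ckEquiv_high_low_mid {x y z : ℕ} (h : y < z) (h' : z < x) (t : List ℕ) :
    CKEquiv (x :: y :: z :: t) (y :: x :: z :: t) :=
  Relation.EqvGen.rel _ _ (Or.inr (Or.inl ⟨[], t, x, y, z, h, h', by simp, by simp⟩))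

theorem ckEquiv_braid (i : ℕ) (t : List ℕ) :
    CKEquiv (i :: (i + 1) :: i :: t) ((i + 1) :: i :: (i + 1) :: t) :=
  Relation.EqvGen.rel _ _ (Or.inr (Or.inr ⟨[], t, i, by simp, by simp⟩))

/-- The three kinds of elementary Coxeter–Knuth triples. -/
inductive CKTriple : List ℕ → List ℕ → Prop
  | midLowHigh {a b c : ℕ} (h : a < b) (h' : b < c) : CKTriple [b, a, c] [b, c, a]
  | highLowMid {a b c : ℕ} (h : a < b) (h' : b < c) : CKTriple [c, a, b] [a, c, b]
  | braid (i : ℕ) : CKTriple [i, i + 1, i] [i + 1, i, i + 1]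

theorem CKTriple.ckEquiv {t t' : List ℕ} (h : CKTriple t t') : CKEquiv t t' := by
  cases h with
  | midLowHigh h h' => exact ckEquiv_mid_low_high h h' []
  | highLowMid h h' => exact ckEquiv_high_low_mid h h' []
  | braid i => exact ckEquiv_braid i []

theorem CKStep.exists_triple {u v : List ℕ} (h : CKStep u v) :
    ∃ a b t t', CKTriple t t' ∧ u = a ++ t ++ b ∧ v = a ++ t' ++ b := by
  rcases h with ⟨c, d, x, y, z, h1, h2, rfl, rfl⟩ | ⟨c, d, x, y, z, h1, h2, rfl, rfl⟩ |
    ⟨c, d, i, rfl, rfl⟩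
  · exact ⟨c, d, _, _, .midLowHigh h1 h2, rfl, rfl⟩
  · exact ⟨c, d, _, _, .highLowMid h1 h2, rfl, rfl⟩
  · exact ⟨c, d, _, _, .braid i, rfl, rfl⟩

theorem CKTriple.wordPerm_eq {t t' : List ℕ} (h : CKTriple t t') : wordPerm t = wordPerm t' := by
  cases h with
  | @midLowHigh a b c h h' =>
    have := sPerm_comm (i := a) (j := c) (by omega)
    simp only [wordPerm_cons, wordPerm_nil, mul_one, this]
  | @highLowMid a b c h h' =>
    have := sPerm_comm (i := a) (j := c) (by omega)
    simp only [wordPerm_cons, wordPerm_nil, mul_one, ← mul_assoc, this]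
  | braid i =>
    have := sPerm_braid i
    simpa only [wordPerm_cons, wordPerm_nil, mul_one, ← mul_assoc] using this

theorem CKTriple.mem_iff {t t' : List ℕ} (h : CKTriple t t') (x : ℕ) : x ∈ t ↔ x ∈ t' := by
  cases h <;> simp <;> tauto

theorem CKTriple.length_eq {t t' : List ℕ} (h : CKTriple t t') : t.length = t'.length := by
  cases h <;> rfl

theorem CKEquiv.wordPerm_eq {u v : List ℕ} (h : CKEquiv u v) : wordPerm u = wordPerm v := by
  induction h with
  | rel x y h =>
    obtain ⟨a, b, t, t', ht, rfl, rfl⟩ := h.exists_triple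
    simp [ht.wordPerm_eq]
  | refl x => rfl
  | symm x y _ ih => exact ih.symm
  | trans x y z _ _ ih ih' => exact ih.trans ih'

theorem CKEquiv.length_eq {u v : List ℕ} (h : CKEquiv u v) : u.length = v.length := by
  induction h with
  | rel x y h =>
    obtain ⟨a, b, t, t', ht, rfl, rfl⟩ := h.exists_triple
    simp [ht.length_eq]
  | refl x => rfl
  | symm x y _ ih => exact ih.symm
  | trans x y z _ _ ih ih' => exact ih.trans ih'

theorem CKEquiv.mem_iff {u v : List ℕ} (h : CKEquiv u v) (x : ℕ) : x ∈ u ↔ x ∈ v := by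
  induction h with
  | rel y z h =>
    obtain ⟨a, b, t, t', ht, rfl, rfl⟩ := h.exists_triple
    simp [ht.mem_iff]
  | refl x => rfl
  | symm x y _ ih => exact ih.symm
  | trans x y z _ _ ih ih' => exact ih.trans ih'

theorem CKEquiv.isReducedWord {u v : List ℕ} (h : CKEquiv u v) (hu : IsReducedWord u) :
    IsReducedWord v :=
  ⟨fun x hx => hu.1 x ((h.mem_iff x).2 hx), fun σ hσ e =>
    h.length_eq ▸ hu.2 σ hσ (e.trans h.wordPerm_eq.symm)⟩

/-! ### Factors of reduced words -/

theorem IsReducedWord.of_middle {a b c : List ℕ} (h : IsReducedWord (a ++ b ++ c)) :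
    IsReducedWord b := by
  refine ⟨h.1.left.right, fun σ hσ e => ?_⟩
  have := h.2 (a ++ σ ++ c) ((h.1.left.left.append hσ).append h.1.right) (by simp [e])
  simp at this
  omega

theorem IsReducedWord.left {a b : List ℕ} (h : IsReducedWord (a ++ b)) : IsReducedWord a :=
  IsReducedWord.of_middle (a := []) (c := b) (by simpa using h)

theorem IsReducedWord.right {a b : List ℕ} (h : IsReducedWord (a ++ b)) : IsReducedWord b :=
  IsReducedWord.of_middle (a := a) (c := []) (by simpa using h)

theorem wordPerm_comm_of_far {x : ℕ} {W : List ℕ} (h : ∀ w ∈ W, w + 2 ≤ x ∨ x + 2 ≤ w) :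
    sPerm x * wordPerm W = wordPerm W * sPerm x := by
  induction W with
  | nil => simp
  | cons w W ih =>
    have h1 := sPerm_comm_of_far (h w (by simp))
    have h2 := ih fun v hv => h v (by simp [hv])
    rw [wordPerm_cons, ← mul_assoc, ← h1, mul_assoc, h2, mul_assoc]

theorem IsReducedWord.exists_near {x : ℕ} {W : List ℕ} (h : IsReducedWord (x :: (W ++ [x]))) :
    ∃ w ∈ W, w ≤ x + 1 ∧ x ≤ w + 1 := by
  by_contra! hc
  have hcomm : sPerm x * wordPerm W = wordPerm W * sPerm x :=
    wordPerm_comm_of_far fun w hw => by have := hc w hw; omega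
  have := h.2 W (fun w hw => h.1 w (by simp [hw])) (by
    rw [wordPerm_cons, wordPerm_append, ← mul_assoc, hcomm]
    simp [mul_assoc, sPerm_mul_self])
  simp at this

theorem IsReducedWord.ne_of_adjacent {a b : List ℕ} {x y : ℕ}
    (h : IsReducedWord (a ++ x :: y :: b)) : x ≠ y := by
  rintro rfl
  have h' : IsReducedWord (x :: ([] ++ [x])) :=
    IsReducedWord.of_middle (a := a) (c := b) (by simpa using h)
  simpa using h'.exists_near

/-! ### Shifting letters -/

theorem CKTriple.map_add (N : ℕ) {t t' : List ℕ} (h : CKTriple t t') :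
    CKTriple (t.map (· + N)) (t'.map (· + N)) := by
  cases h with
  | midLowHigh h h' => exact .midLowHigh (by dsimp only; omega) (by dsimp only; omega)
  | highLowMid h h' => exact .highLowMid (by dsimp only; omega) (by dsimp only; omega)
  | braid i =>
    have := CKTriple.braid (i + N)
    simpa [add_right_comm] using this

theorem CKTriple.map_sub (N : ℕ) {t t' : List ℕ} (h : CKTriple t t') (ht : ∀ x ∈ t, N ≤ x) :
    CKTriple (t.map (· - N)) (t'.map (· - N)) := by
  cases h with
  | midLowHigh h h' => simp at ht; exact .midLowHigh (by dsimp only; omega) (by dsimp only; omega)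
  | highLowMid h h' => simp at ht; exact .highLowMid (by dsimp only; omega) (by dsimp only; omega)
  | braid i =>
    have := CKTriple.braid (i - N)
    simp at ht
    have e : i + 1 - N = i - N + 1 := by omega
    simpa [e] using this

theorem CKEquiv.map_add (N : ℕ) {u v : List ℕ} (h : CKEquiv u v) :
    CKEquiv (u.map (· + N)) (v.map (· + N)) := by
  induction h with
  | rel y z h =>
    obtain ⟨a, b, t, t', ht, rfl, rfl⟩ := h.exists_triple
    simpa using (ht.map_add N).ckEquiv.append_append (a.map (· + N)) (b.map (· + N))
  | refl x => exact CKEquiv.refl _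
  | symm x y _ ih => exact ih.symm
  | trans x y z _ _ ih ih' => exact ih.trans ih'

theorem CKEquiv.map_sub (N : ℕ) {u v : List ℕ} (h : CKEquiv u v) (hu : ∀ x ∈ u, N ≤ x) :
    CKEquiv (u.map (· - N)) (v.map (· - N)) := by
  induction h with
  | rel y z h =>
    obtain ⟨a, b, t, t', ht, rfl, rfl⟩ := h.exists_triple
    have h2 : ∀ x ∈ t, N ≤ x := fun x hx => hu x (by simp [hx])
    simpa using (ht.map_sub N h2).ckEquiv.append_append (a.map (· - N)) (b.map (· - N))
  | refl x => exact CKEquiv.refl _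
  | symm x y h ih => exact (ih fun z hz => hu z ((CKEquiv.mem_iff h z).1 hz)).symm
  | trans x y z h _ ih ih' =>
    exact (ih hu).trans (ih' fun w hw => hu w ((CKEquiv.mem_iff h w).2 hw))

theorem map_sub_map_add {N : ℕ} {u : List ℕ} (h : ∀ x ∈ u, N ≤ x) :
    (u.map (· - N)).map (· + N) = u := by
  rw [List.map_map]
  conv_rhs => rw [← List.map_id u]
  exact List.map_congr_left fun x hx => by have := h x hx; simp; omega

theorem map_add_map_sub (N : ℕ) (u : List ℕ) : (u.map (· + N)).map (· - N) = u := by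
  simp [List.map_map, Function.comp_def]

theorem CKEquiv.exists_of_map_add {N : ℕ} {u v : List ℕ} (h : CKEquiv (u.map (· + N)) v) :
    ∃ v', v = v'.map (· + N) ∧ CKEquiv u v' := by
  have hu : ∀ x ∈ u.map (· + N), N ≤ x := by simp
  refine ⟨v.map (· - N), (map_sub_map_add fun x hx => hu x ((h.mem_iff x).2 hx)).symm, ?_⟩
  simpa only [map_add_map_sub] using h.map_sub N hu

theorem CKEquiv.of_map_add {N : ℕ} {u v : List ℕ}
    (h : CKEquiv (u.map (· + N)) (v.map (· + N))) : CKEquiv u v := by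
  have := h.map_sub N (by simp)
  rwa [map_add_map_sub, map_add_map_sub] at this

/-- The increasing injection of `ℕ` into itself whose image misses exactly `p`. -/
def skipAt (p x : ℕ) : ℕ := if x < p then x else x + 1

theorem exists_delete_strand (σ : List ℕ) (hσ : PosWord σ) (p : ℕ) (hp : 1 ≤ p) :
    1 ≤ wordPerm σ p ∧ ∃ σ', PosWord σ' ∧ σ'.length ≤ σ.length ∧
      ∀ x, wordPerm σ (skipAt p x) = skipAt (wordPerm σ p) (wordPerm σ' x) := by
  induction σ with
  | nil => exact ⟨by simpa using hp, [], by simp [PosWord], le_rfl, by simp⟩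
  | cons i σ ih =>
    obtain ⟨h1, σ', hpos, hlen, hx⟩ := ih fun x hx => hσ x (by simp [hx])
    have hi : 1 ≤ i := hσ i (by simp)
    simp only [wordPerm_cons, Equiv.Perm.mul_apply]
    simp only [hx]
    generalize wordPerm σ p = q at *
    refine ⟨by simp only [sPerm, Equiv.swap_apply_def]; split_ifs <;> omega, ?_⟩
    by_cases hq : i = q ∨ i + 1 = q
    · refine ⟨σ', hpos, by simp; omega, fun x => ?_⟩
      generalize wordPerm σ' x = y
      simp only [sPerm, Equiv.swap_apply_def, skipAt]
      split_ifs <;> omega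
    · refine ⟨(if i < q then i else i - 1) :: σ', ?_, by simpa using hlen, fun x => ?_⟩
      · intro x hx
        rcases List.mem_cons.1 hx with rfl | hx
        · split_ifs <;> omega
        · exact hpos x hx
      · simp only [wordPerm_cons, Equiv.Perm.mul_apply]
        generalize wordPerm σ' x = y
        simp only [sPerm, Equiv.swap_apply_def, skipAt]
        split_ifs <;> omega

theorem wordPerm_map_succ {ρ : List ℕ} (hρ : PosWord ρ) :
    wordPerm (ρ.map (· + 1)) 1 = 1 ∧
      ∀ x, wordPerm (ρ.map (· + 1)) (skipAt 1 x) = skipAt 1 (wordPerm ρ x) := by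
  induction ρ with
  | nil => simp
  | cons i ρ ih =>
    obtain ⟨h1, h2⟩ := ih fun x hx => hρ x (by simp [hx])
    have hi : 1 ≤ i := hρ i (by simp)
    simp only [List.map_cons, wordPerm_cons, Equiv.Perm.mul_apply, h1, h2]
    refine ⟨?_, fun x => ?_⟩
    · simp only [sPerm, Equiv.swap_apply_def]
      split_ifs <;> omega
    · generalize wordPerm ρ x = y
      simp only [sPerm, Equiv.swap_apply_def, skipAt]
      split_ifs <;> omega

theorem skipAt_injective (p : ℕ) : Function.Injective (skipAt p) := by
  intro x y h
  simp only [skipAt] at h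
  split_ifs at h <;> omega

theorem IsReducedWord.map_succ {ρ : List ℕ} (h : IsReducedWord ρ) :
    IsReducedWord (ρ.map (· + 1)) := by
  refine ⟨fun x hx => ?_, fun σ hσ e => ?_⟩
  · obtain ⟨y, -, rfl⟩ := List.mem_map.1 hx
    omega
  · obtain ⟨h1, h2⟩ := wordPerm_map_succ h.1
    obtain ⟨-, σ', hpos, hlen, hx⟩ := exists_delete_strand σ hσ 1 le_rfl
    rw [e] at hx
    simp only [h1, h2] at hx
    have : wordPerm σ' = wordPerm ρ := Equiv.ext fun x => (skipAt_injective 1 (hx x)).symm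
    simpa using (h.2 σ' hpos this).trans hlen

theorem IsReducedWord.map_add {ρ : List ℕ} (h : IsReducedWord ρ) (N : ℕ) :
    IsReducedWord (ρ.map (· + N)) := by
  induction N with
  | zero => simpa using h
  | succ N ih => simpa [List.map_map, Function.comp_def, add_assoc] using ih.map_succ

theorem wordPerm_map_add_apply (N : ℕ) (ρ : List ℕ) (x : ℕ) :
    wordPerm (ρ.map (· + N)) (x + N) = wordPerm ρ x + N := by
  induction ρ with
  | nil => simp
  | cons i ρ ih =>
    simp only [List.map_cons, wordPerm_cons, Equiv.Perm.mul_apply, ih]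
    simp only [sPerm, Equiv.swap_apply_def]
    split_ifs <;> omega

theorem wordPerm_map_add_apply_of_le (N : ℕ) {ρ : List ℕ} (hρ : PosWord ρ) {x : ℕ} (hx : x ≤ N) :
    wordPerm (ρ.map (· + N)) x = x := by
  induction ρ with
  | nil => simp
  | cons i ρ ih =>
    have hi : 1 ≤ i := hρ i (by simp)
    simp only [List.map_cons, wordPerm_cons, Equiv.Perm.mul_apply,
      ih fun y hy => hρ y (by simp [hy])]
    simp only [sPerm, Equiv.swap_apply_def]
    split_ifs <;> omega

/-! ### Edelman–Greene insertion into a single row -/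

/-- Strictly increasing words. -/
abbrev Incr (R : List ℕ) : Prop := R.Pairwise (· < ·)

/-- The row obtained by Edelman–Greene insertion of a letter into an increasing row. -/
def rowIns : List ℕ → ℕ → List ℕ
  | [], x => [x]
  | a :: R, x => if x < a then x :: R else if x = a then a :: R else a :: rowIns R x

/-- The letter (if any) bumped by Edelman–Greene insertion of a letter into a row. -/
def rowBump : List ℕ → ℕ → List ℕ
  | [], _ => []
  | a :: R, x => if x < a then [a] else if x = a then [a + 1] else rowBump R x

/-- The row obtained by inserting the letters of a word one after the other. -/
def insW : List ℕ → List ℕ → List ℕ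
  | R, [] => R
  | R, x :: t => insW (rowIns R x) t

/-- The word of letters bumped when inserting a word into a row. -/
def bumpW : List ℕ → List ℕ → List ℕ
  | _, [] => []
  | R, x :: t => rowBump R x ++ bumpW (rowIns R x) t

@[simp] theorem insW_nil (R : List ℕ) : insW R [] = R := by simp [insW]

@[simp] theorem bumpW_nil (R : List ℕ) : bumpW R [] = [] := by simp [bumpW]

@[simp] theorem insW_cons (R t : List ℕ) (x : ℕ) : insW R (x :: t) = insW (rowIns R x) t := by
  simp [insW]

@[simp] theorem bumpW_cons (R t : List ℕ) (x : ℕ) :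
    bumpW R (x :: t) = rowBump R x ++ bumpW (rowIns R x) t := by
  simp [bumpW]

@[simp] theorem insW_append (R t s : List ℕ) : insW R (t ++ s) = insW (insW R t) s := by
  induction t generalizing R with
  | nil => simp
  | cons x t ih => simp [ih]

@[simp] theorem bumpW_append (R t s : List ℕ) :
    bumpW R (t ++ s) = bumpW R t ++ bumpW (insW R t) s := by
  induction t generalizing R with
  | nil => simp
  | cons x t ih => simp [ih]

theorem rowIns_nil (x : ℕ) : rowIns [] x = [x] := by simp [rowIns]

theorem rowBump_nil (x : ℕ) : rowBump [] x = [] := by simp [rowBump]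

theorem rowIns_of_lt {a x : ℕ} (h : x < a) (R : List ℕ) : rowIns (a :: R) x = x :: R := by
  simp [rowIns, h]

theorem rowBump_of_lt {a x : ℕ} (h : x < a) (R : List ℕ) : rowBump (a :: R) x = [a] := by
  simp [rowBump, h]

theorem rowIns_of_eq (a : ℕ) (R : List ℕ) : rowIns (a :: R) a = a :: R := by
  simp [rowIns]

theorem rowBump_of_eq (a : ℕ) (R : List ℕ) : rowBump (a :: R) a = [a + 1] := by
  simp [rowBump]

theorem rowIns_of_gt {a x : ℕ} (h : a < x) (R : List ℕ) :
    rowIns (a :: R) x = a :: rowIns R x := by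
  simp [rowIns, h.not_gt, h.ne']

theorem rowBump_of_gt {a x : ℕ} (h : a < x) (R : List ℕ) :
    rowBump (a :: R) x = rowBump R x := by
  simp [rowBump, h.not_gt, h.ne']

theorem mem_rowIns {R : List ℕ} {x y : ℕ} (h : y ∈ rowIns R x) : y = x ∨ y ∈ R := by
  induction R with
  | nil => simpa [rowIns] using h
  | cons a R ih =>
    simp only [rowIns] at h
    split_ifs at h <;> simp at h ⊢ <;> tauto

theorem lt_of_mem_rowIns {R : List ℕ} {h x : ℕ} (hR : ∀ r ∈ R, h < r) (hx : h < x) :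
    ∀ r ∈ rowIns R x, h < r := fun r hr => by
  rcases mem_rowIns hr with rfl | hr
  · exact hx
  · exact hR r hr

theorem Incr.rowIns {R : List ℕ} (hR : Incr R) (x : ℕ) : Incr (rowIns R x) := by
  induction R with
  | nil => simp [_root_.rowIns]
  | cons a R ih =>
    obtain ⟨h1, h2⟩ := List.pairwise_cons.1 hR
    rcases lt_trichotomy x a with h | rfl | h
    · rw [rowIns_of_lt h]
      exact List.pairwise_cons.2 ⟨fun r hr => h.trans (h1 r hr), h2⟩
    · rwa [rowIns_of_eq]
    · rw [rowIns_of_gt h]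
      exact List.pairwise_cons.2 ⟨lt_of_mem_rowIns h1 h, ih h2⟩

theorem Incr.insW {R : List ℕ} (hR : Incr R) (t : List ℕ) : Incr (insW R t) := by
  induction t generalizing R with
  | nil => simpa
  | cons x t ih => simpa using ih (hR.rowIns x)

theorem rowBump_eq_nil_or {R : List ℕ} (x : ℕ) :
    rowBump R x = [] ∨ ∃ y, rowBump R x = [y] ∧ x < y := by
  induction R with
  | nil => simp [rowBump]
  | cons a R ih =>
    rcases lt_trichotomy x a with h | rfl | h
    · exact Or.inr ⟨a, rowBump_of_lt h R, h⟩
    · exact Or.inr ⟨x + 1, rowBump_of_eq x R, by omega⟩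
    · rwa [rowBump_of_gt h]

theorem lt_rowBump {R : List ℕ} {h x y : ℕ} (hR : ∀ r ∈ R, h < r)
    (hy : rowBump R x = [y]) : h < y := by
  induction R with
  | nil => simp [rowBump] at hy
  | cons a R ih =>
    have := hR a (by simp)
    simp only [rowBump] at hy
    split_ifs at hy
    · simp at hy; omega
    · simp at hy; omega
    · exact ih (fun r hr => hR r (by simp [hr])) hy

theorem exists_rowIns_eq_cons (R : List ℕ) (x : ℕ) : ∃ z t, rowIns R x = z :: t ∧ z ≤ x := by
  cases R with
  | nil => exact ⟨x, [], by simp [rowIns], le_rfl⟩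
  | cons a R =>
    rcases lt_trichotomy x a with h | rfl | h
    · exact ⟨x, R, rowIns_of_lt h R, le_rfl⟩
    · exact ⟨x, R, rowIns_of_eq x R, le_rfl⟩
    · exact ⟨a, _, rowIns_of_gt h R, h.le⟩

theorem length_rowIns_add (R : List ℕ) (x : ℕ) :
    (rowIns R x).length + (rowBump R x).length = R.length + 1 := by
  induction R with
  | nil => simp [rowIns, rowBump]
  | cons a R ih =>
    simp only [rowIns, rowBump]
    split_ifs
    · simp
    · simp
    · simp; omega

theorem length_insW_add (R t : List ℕ) :
    (insW R t).length + (bumpW R t).length = R.length + t.length := by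
  induction t generalizing R with
  | nil => simp
  | cons x t ih =>
    have h1 := ih (rowIns R x)
    have h2 := length_rowIns_add R x
    simp
    omega

theorem insW_cons_of_lt {h : ℕ} {t : List ℕ} (ht : ∀ x ∈ t, h < x) (R : List ℕ) :
    insW (h :: R) t = h :: insW R t := by
  induction t generalizing R with
  | nil => simp
  | cons x t ih =>
    rw [insW_cons, rowIns_of_gt (ht x (by simp)), ih fun y hy => ht y (by simp [hy]), insW_cons]

theorem bumpW_cons_of_lt {h : ℕ} {t : List ℕ} (ht : ∀ x ∈ t, h < x) (R : List ℕ) :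
    bumpW (h :: R) t = bumpW R t := by
  induction t generalizing R with
  | nil => simp
  | cons x t ih =>
    have hx := ht x (by simp)
    rw [bumpW_cons, rowIns_of_gt hx, rowBump_of_gt hx, ih fun y hy => ht y (by simp [hy]),
      bumpW_cons]

theorem succ_mem_of_isReducedWord {R : List ℕ} {x : ℕ} (hR : Incr R)
    (h : IsReducedWord (R ++ [x])) (hx : x ∈ R) : x + 1 ∈ R := by
  obtain ⟨R1, R2, rfl⟩ := List.append_of_mem hx
  have h' : IsReducedWord (x :: (R2 ++ [x])) := IsReducedWord.right (a := R1) (by simpa using h)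
  obtain ⟨w, hw, hw1, hw2⟩ := h'.exists_near
  have := (List.pairwise_cons.1 (List.pairwise_append.1 hR).2.1).1 w hw
  obtain rfl : w = x + 1 := by omega
  simp [hw]

theorem exists_tail_eq_succ_cons {R : List ℕ} {x : ℕ} (hR : Incr (x :: R))
    (h : IsReducedWord (x :: R ++ [x])) : ∃ R', R = (x + 1) :: R' := by
  have h1 := succ_mem_of_isReducedWord hR h (by simp)
  simp at h1
  cases R with
  | nil => simp at h1
  | cons a R =>
    obtain ⟨h2, h3⟩ := List.pairwise_cons.1 hR
    have h4 := h2 a (by simp)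
    rcases List.mem_cons.1 h1 with rfl | h5
    · exact ⟨R, rfl⟩
    · have := (List.pairwise_cons.1 h3).1 _ h5
      omega

/-! ### Sliding letters across increasing words -/

theorem ckEquiv_slide_small {a w : ℕ} (hw : w < a) {X : List ℕ} (hX : Incr (a :: X)) :
    CKEquiv (a :: w :: X) (a :: X ++ [w]) := by
  induction X generalizing a with
  | nil => exact CKEquiv.refl _
  | cons x X ih =>
    obtain ⟨h1, h2⟩ := List.pairwise_cons.1 hX
    have hax := h1 x (by simp)
    exact (ckEquiv_mid_low_high hw hax X).trans ((ih (hw.trans hax) h2).cons a)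

theorem ckEquiv_slide_large {a x : ℕ} (hx : x < a) {W : List ℕ} (hW : Incr (W ++ [x])) :
    CKEquiv (a :: (W ++ [x])) (W ++ [a, x]) := by
  induction W with
  | nil => exact CKEquiv.refl _
  | cons w W ih =>
    obtain ⟨h1, h2⟩ := List.pairwise_cons.1 hW
    refine CKEquiv.trans ?_ ((ih h2).cons w)
    cases W with
    | nil => exact ckEquiv_high_low_mid (h1 x (by simp)) hx []
    | cons v V =>
      have hv : v < x := (List.pairwise_append.1 h2).2.2 v (by simp) x (by simp)
      exact ckEquiv_high_low_mid (h1 v (by simp)) (hv.trans hx) _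

theorem ckEquiv_rowIns {R : List ℕ} {x : ℕ} (hR : Incr R) (h : IsReducedWord (R ++ [x])) :
    CKEquiv (R ++ [x]) (rowBump R x ++ rowIns R x) := by
  induction R with
  | nil => exact CKEquiv.of_eq (by simp [rowBump, rowIns])
  | cons a R ih =>
    obtain ⟨h1, h2⟩ := List.pairwise_cons.1 hR
    rcases lt_trichotomy x a with hx | rfl | hx
    · rw [rowBump_of_lt hx, rowIns_of_lt hx]
      exact (ckEquiv_slide_small hx hR).symm
    · rw [rowBump_of_eq, rowIns_of_eq]
      obtain ⟨R', rfl⟩ := exists_tail_eq_succ_cons hR h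
      exact ((ckEquiv_slide_small (by omega) h2).symm.cons x).trans (ckEquiv_braid x R')
    · rw [rowBump_of_gt hx, rowIns_of_gt hx]
      have h3 := (ih h2 (IsReducedWord.right (a := [a]) h)).cons a
      refine h3.trans ?_
      rcases rowBump_eq_nil_or (R := R) x with e | ⟨y, e, hy⟩
      · rw [e]; exact CKEquiv.refl _
      · obtain ⟨z, t, ez, hz⟩ := exists_rowIns_eq_cons R x
        have := lt_of_mem_rowIns h1 hx z (by simp [ez])
        rw [e, ez]
        exact (ckEquiv_high_low_mid this (by omega) t).symm

theorem ckEquiv_insW {R t : List ℕ} (hR : Incr R) (h : IsReducedWord (R ++ t)) :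
    CKEquiv (R ++ t) (bumpW R t ++ insW R t) := by
  induction t generalizing R with
  | nil => exact CKEquiv.of_eq (by simp)
  | cons x t ih =>
    have e : R ++ x :: t = R ++ [x] ++ t := by simp
    rw [e] at h ⊢
    have h1 := (ckEquiv_rowIns hR h.left).append_right t
    have h2 := h1.isReducedWord h
    rw [List.append_assoc (rowBump R x)] at h1 h2
    refine h1.trans (((ih (hR.rowIns x) h2.right).append_left _).trans (CKEquiv.of_eq ?_))
    simp

theorem isReducedWord_insW_append {R t s : List ℕ} (hR : Incr R)
    (h : IsReducedWord (R ++ (t ++ s))) : IsReducedWord (insW R t ++ s) := by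
  rw [← List.append_assoc] at h
  have h1 := ((ckEquiv_insW hR h.left).append_right s).isReducedWord h
  rw [List.append_assoc] at h1
  exact h1.right

theorem isReducedWord_rowIns_append {R s : List ℕ} {x : ℕ} (hR : Incr R)
    (h : IsReducedWord (R ++ (x :: s))) : IsReducedWord (rowIns R x ++ s) := by
  simpa using isReducedWord_insW_append (t := [x]) hR h

/-! ### Coxeter–Knuth invariance of row insertion -/

theorem rowBump_after_smaller {R : List ℕ} (hR : Incr R) {b c : ℕ} (hbc : b < c) :
    rowBump (rowIns R b) c = [] ∨
      ∃ y y', rowBump R b = [y] ∧ rowBump (rowIns R b) c = [y'] ∧ y < y' := by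
  induction R with
  | nil => left; simp [rowIns, rowBump, hbc.not_gt, hbc.ne']
  | cons a R ih =>
    obtain ⟨h1, h2⟩ := List.pairwise_cons.1 hR
    rcases lt_trichotomy b a with h | rfl | h
    · rw [rowIns_of_lt h, rowBump_of_lt h, rowBump_of_gt hbc]
      rcases rowBump_eq_nil_or (R := R) c with e | ⟨y, e, hy⟩
      · exact Or.inl e
      · exact Or.inr ⟨a, y, rfl, e, lt_rowBump h1 e⟩
    · rw [rowIns_of_eq, rowBump_of_eq, rowBump_of_gt hbc]
      rcases rowBump_eq_nil_or (R := R) c with e | ⟨y, e, hy⟩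
      · exact Or.inl e
      · exact Or.inr ⟨b + 1, y, rfl, e, by omega⟩
    · rw [rowIns_of_gt h, rowBump_of_gt h, rowBump_of_gt (h.trans hbc)]
      exact ih h2

theorem rowBump_after_larger (R : List ℕ) {b c : ℕ} (hbc : b < c) :
    ∃ y, rowBump (rowIns R c) b = [y] ∧ y ≤ c := by
  induction R with
  | nil => exact ⟨c, by simp [rowIns, rowBump, hbc], le_rfl⟩
  | cons a R ih =>
    rcases lt_trichotomy c a with h | rfl | h
    · exact ⟨c, by rw [rowIns_of_lt h, rowBump_of_lt hbc], le_rfl⟩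
    · exact ⟨c, by rw [rowIns_of_eq, rowBump_of_lt hbc], le_rfl⟩
    · rw [rowIns_of_gt h]
      rcases lt_trichotomy b a with h' | rfl | h'
      · exact ⟨a, rowBump_of_lt h' _, h.le⟩
      · exact ⟨b + 1, rowBump_of_eq _ _, hbc⟩
      · rw [rowBump_of_gt h']; exact ih

theorem insW_midLowHigh {R : List ℕ} (hR : Incr R) {a b c : ℕ} (hab : a < b) (hbc : b < c)
    (h : IsReducedWord (R ++ [b, a, c])) :
    insW R [b, a, c] = insW R [b, c, a] ∧ CKEquiv (bumpW R [b, a, c]) (bumpW R [b, c, a]) := by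
  have hac := hab.trans hbc
  induction R with
  | nil =>
    simp only [insW_cons, insW_nil, bumpW_cons, bumpW_nil, rowIns_nil, rowBump_nil,
      rowIns_of_lt hab, rowBump_of_lt hab, rowIns_of_gt hac, rowBump_of_gt hac, rowIns_of_gt hbc,
      rowBump_of_gt hbc]
    exact ⟨trivial, CKEquiv.refl _⟩
  | cons r R ih =>
    obtain ⟨h1, h2⟩ := List.pairwise_cons.1 hR
    rcases lt_trichotomy b r with hb | rfl | hb
    · simp only [insW_cons, insW_nil, bumpW_cons, bumpW_nil,
        rowIns_of_lt hab, rowBump_of_lt hab, rowIns_of_gt hac, rowBump_of_gt hac,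
        rowIns_of_gt hbc, rowBump_of_gt hbc, rowIns_of_lt hb, rowBump_of_lt hb]
      refine ⟨trivial, ?_⟩
      rcases rowBump_eq_nil_or (R := R) c with e | ⟨y, e, hy⟩
      · rw [e]; exact CKEquiv.refl _
      · rw [e]; exact ckEquiv_mid_low_high hb (lt_rowBump h1 e) []
    · simp only [insW_cons, insW_nil, bumpW_cons, bumpW_nil,
        rowIns_of_lt hab, rowBump_of_lt hab, rowIns_of_gt hac, rowBump_of_gt hac,
        rowIns_of_gt hbc, rowBump_of_gt hbc, rowIns_of_eq, rowBump_of_eq]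
      refine ⟨trivial, ?_⟩
      rcases rowBump_eq_nil_or (R := R) c with e | ⟨y, e, hy⟩
      · rw [e]; exact CKEquiv.refl _
      · rw [e]; exact ckEquiv_mid_low_high (by omega) (by omega) []
    · have key : ∀ e, e < b →
          CKEquiv (rowBump R b ++ e :: rowBump (rowIns R b) c)
            (rowBump R b ++ (rowBump (rowIns R b) c ++ [e])) := by
        intro e he
        rcases rowBump_after_smaller h2 hbc with e1 | ⟨y, y', e1, e2, hy⟩
        · rw [e1]; exact CKEquiv.refl _
        · have : b < y := by
            rcases rowBump_eq_nil_or (R := R) b with e3 | ⟨z, e3, hz⟩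
            · simp [e3] at e1
            · rw [e3] at e1; simp at e1; omega
          rw [e1, e2]; exact ckEquiv_mid_low_high (by omega) hy []
      have hrc := hb.trans hbc
      rcases lt_trichotomy a r with ha | rfl | ha
      · simp only [insW_cons, insW_nil, bumpW_cons, bumpW_nil,
          rowIns_of_lt ha, rowBump_of_lt ha, rowIns_of_gt hac, rowBump_of_gt hac,
          rowIns_of_gt hb, rowBump_of_gt hb, rowIns_of_gt hrc, rowBump_of_gt hrc]
        exact ⟨trivial, by simpa using key r hb⟩
      · simp only [insW_cons, insW_nil, bumpW_cons, bumpW_nil,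
          rowIns_of_eq, rowBump_of_eq, rowIns_of_gt hac, rowBump_of_gt hac,
          rowIns_of_gt hb, rowBump_of_gt hb]
        refine ⟨trivial, ?_⟩
        rcases (Nat.succ_le_of_lt hb).lt_or_eq with hlt | heq
        · simpa using key (a + 1) hlt
        · rcases rowBump_after_smaller h2 hbc with e1 | ⟨y, y', e1, e2, hy⟩
          · rw [e1]; exact CKEquiv.refl _
          · have : b < y := by
              rcases rowBump_eq_nil_or (R := R) b with e3 | ⟨z, e3, hz⟩
              · simp [e3] at e1
              · rw [e3] at e1; simp at e1; omega
            rw [e1, e2]; exact ckEquiv_mid_low_high (by omega) hy []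
      · have ht : ∀ x ∈ [b, a, c], r < x := by simp; omega
        have ht' : ∀ x ∈ [b, c, a], r < x := by simp; omega
        rw [insW_cons_of_lt ht, insW_cons_of_lt ht', bumpW_cons_of_lt ht, bumpW_cons_of_lt ht']
        obtain ⟨e1, e2⟩ := ih h2 (IsReducedWord.right (a := [r]) h)
        exact ⟨by rw [e1], e2⟩

theorem insW_highLowMid {R : List ℕ} (hR : Incr R) {a b c : ℕ} (hab : a < b) (hbc : b < c)
    (h : IsReducedWord (R ++ [c, a, b])) :
    insW R [c, a, b] = insW R [a, c, b] ∧ CKEquiv (bumpW R [c, a, b]) (bumpW R [a, c, b]) := by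
  have hac := hab.trans hbc
  induction R with
  | nil =>
    simp only [insW_cons, insW_nil, bumpW_cons, bumpW_nil, rowIns_nil, rowBump_nil,
      rowIns_of_lt hac, rowBump_of_lt hac, rowIns_of_gt hac, rowBump_of_gt hac, rowIns_of_gt hab,
      rowBump_of_gt hab, rowIns_of_lt hbc, rowBump_of_lt hbc]
    exact ⟨trivial, CKEquiv.refl _⟩
  | cons r R ih =>
    obtain ⟨h1, h2⟩ := List.pairwise_cons.1 hR
    obtain ⟨y2, e2, hy2⟩ := rowBump_after_larger R hbc
    have hby2 : b < y2 := by
      rcases rowBump_eq_nil_or (R := rowIns R c) b with e3 | ⟨z, e3, hz⟩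
      · simp [e3] at e2
      · rw [e3] at e2; simp at e2; omega
    have key : ∀ e, e < y2 →
        CKEquiv (rowBump R c ++ e :: rowBump (rowIns R c) b)
          (e :: (rowBump R c ++ (rowBump (rowIns R c) b))) := by
      intro e he
      rcases rowBump_eq_nil_or (R := R) c with e1 | ⟨y1, e1, hy1⟩
      · rw [e1]; exact CKEquiv.refl _
      · rw [e1, e2]; exact ckEquiv_high_low_mid he (by omega) []
    rcases lt_trichotomy a r with ha | rfl | ha
    · rcases lt_trichotomy c r with hc | rfl | hc
      · simp only [insW_cons, insW_nil, bumpW_cons, bumpW_nil,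
          rowIns_of_lt ha, rowBump_of_lt ha, rowIns_of_gt hac, rowBump_of_gt hac,
          rowIns_of_lt hc, rowBump_of_lt hc, rowIns_of_gt hab, rowBump_of_gt hab,
          rowIns_of_lt hac, rowBump_of_lt hac]
        cases R with
        | nil =>
          simp only [rowIns_nil, rowBump_nil, rowIns_of_lt hbc, rowBump_of_lt hbc]
          exact ⟨trivial, CKEquiv.refl _⟩
        | cons r' R =>
          have hr' := h1 r' (by simp)
          have hcr : c < r' := hc.trans hr'
          have hbr : b < r' := hbc.trans hcr
          simp only [rowIns_of_lt hcr, rowBump_of_lt hcr, rowIns_of_lt hbr, rowBump_of_lt hbr,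
            rowIns_of_lt hbc, rowBump_of_lt hbc]
          exact ⟨trivial, ckEquiv_mid_low_high hc hr' []⟩
      · obtain ⟨R', rfl⟩ := exists_tail_eq_succ_cons hR
          (IsReducedWord.left (b := [a, b]) (by simpa using h))
        have hc1 : c < c + 1 := by omega
        have hb1 : b < c + 1 := by omega
        simp only [insW_cons, insW_nil, bumpW_cons, bumpW_nil,
          rowIns_of_lt ha, rowBump_of_lt ha, rowIns_of_gt hac, rowBump_of_gt hac,
          rowIns_of_eq, rowBump_of_eq, rowIns_of_gt hab, rowBump_of_gt hab,
          rowIns_of_lt hc1, rowBump_of_lt hc1,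
          rowIns_of_lt hb1, rowBump_of_lt hb1, rowIns_of_lt hbc, rowBump_of_lt hbc]
        exact ⟨trivial, (ckEquiv_braid c []).symm⟩
      · simp only [insW_cons, insW_nil, bumpW_cons, bumpW_nil,
          rowIns_of_lt ha, rowBump_of_lt ha, rowIns_of_gt hac, rowBump_of_gt hac,
          rowIns_of_gt hc, rowBump_of_gt hc, rowIns_of_gt hab, rowBump_of_gt hab]
        refine ⟨trivial, ?_⟩
        simpa using key r (lt_rowBump (lt_of_mem_rowIns h1 hc) e2)
    · simp only [insW_cons, insW_nil, bumpW_cons, bumpW_nil,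
          rowIns_of_gt hac, rowBump_of_gt hac,
          rowIns_of_eq, rowBump_of_eq, rowIns_of_gt hab, rowBump_of_gt hab]
      refine ⟨trivial, ?_⟩
      simpa using key (a + 1) (by omega)
    · have ht : ∀ x ∈ [c, a, b], r < x := by simp; omega
      have ht' : ∀ x ∈ [a, c, b], r < x := by simp; omega
      rw [insW_cons_of_lt ht, insW_cons_of_lt ht', bumpW_cons_of_lt ht, bumpW_cons_of_lt ht']
      obtain ⟨e1, e2⟩ := ih h2 (IsReducedWord.right (a := [r]) h)
      exact ⟨by rw [e1], e2⟩

theorem insW_braid {R : List ℕ} (hR : Incr R) (i : ℕ)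
    (h : IsReducedWord (R ++ [i, i + 1, i])) :
    insW R [i, i + 1, i] = insW R [i + 1, i, i + 1] ∧
      CKEquiv (bumpW R [i, i + 1, i]) (bumpW R [i + 1, i, i + 1]) := by
  have hi : i < i + 1 := by omega
  induction R with
  | nil =>
    simp only [insW_cons, insW_nil, bumpW_cons, bumpW_nil, rowIns_nil, rowBump_nil,
      rowIns_of_lt hi, rowBump_of_lt hi, rowIns_of_gt hi, rowBump_of_gt hi, rowIns_of_eq,
      rowBump_of_eq]
    exact ⟨trivial, CKEquiv.refl _⟩
  | cons r R ih =>
    obtain ⟨h1, h2⟩ := List.pairwise_cons.1 hR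
    rcases lt_trichotomy i r with hr | rfl | hr
    · rcases (Nat.succ_le_of_lt hr).lt_or_eq with hlt | rfl
      · simp only [insW_cons, insW_nil, bumpW_cons, bumpW_nil, rowIns_of_lt hr, rowBump_of_lt hr,
          rowIns_of_lt hi, rowBump_of_lt hi, rowIns_of_gt hi, rowBump_of_gt hi, rowIns_of_eq,
          rowBump_of_eq, rowIns_of_lt hlt, rowBump_of_lt hlt]
        refine ⟨trivial, ?_⟩
        rcases rowBump_eq_nil_or (R := R) (i + 1) with e | ⟨y, e, hy⟩
        · rw [e]; exact CKEquiv.refl _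
        · rw [e]; exact (ckEquiv_mid_low_high hlt (lt_rowBump h1 e) []).symm
      · have h3 := ((ckEquiv_braid i []).append_left (i.succ :: R)).isReducedWord h
        obtain ⟨R', rfl⟩ := exists_tail_eq_succ_cons hR
          (IsReducedWord.left (b := [i, i + 1]) (by simpa using h3))
        have hi2 : i + 1 < i + 1 + 1 := by omega
        simp only [Nat.succ_eq_add_one, insW_cons, insW_nil, bumpW_cons, bumpW_nil,
          rowIns_of_lt hi, rowBump_of_lt hi, rowIns_of_gt hi, rowBump_of_gt hi, rowIns_of_eq,
          rowBump_of_eq, rowIns_of_lt hi2, rowBump_of_lt hi2]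
        exact ⟨trivial, ckEquiv_braid (i + 1) []⟩
    · obtain ⟨R', rfl⟩ := exists_tail_eq_succ_cons hR
        (IsReducedWord.left (b := [i + 1, i]) (by simpa using h))
      simp only [insW_cons, insW_nil, bumpW_cons, bumpW_nil, rowIns_of_gt hi, rowBump_of_gt hi,
        rowIns_of_eq, rowBump_of_eq]
      exact ⟨trivial, ckEquiv_braid (i + 1) []⟩
    · have ht : ∀ x ∈ [i, i + 1, i], r < x := by simp; omega
      have ht' : ∀ x ∈ [i + 1, i, i + 1], r < x := by simp; omega
      rw [insW_cons_of_lt ht, insW_cons_of_lt ht', bumpW_cons_of_lt ht, bumpW_cons_of_lt ht']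
      obtain ⟨e1, e2⟩ := ih h2 (IsReducedWord.right (a := [r]) h)
      exact ⟨by rw [e1], e2⟩

theorem CKTriple.insW {R t t' : List ℕ} (hR : Incr R) (ht : CKTriple t t')
    (h : IsReducedWord (R ++ t)) :
    insW R t = insW R t' ∧ CKEquiv (bumpW R t) (bumpW R t') := by
  cases ht with
  | midLowHigh h1 h2 => exact insW_midLowHigh hR h1 h2 h
  | highLowMid h1 h2 => exact insW_highLowMid hR h1 h2 h
  | braid i => exact insW_braid hR i h

theorem CKEquiv.insW {R u v : List ℕ} (hR : Incr R) (huv : CKEquiv u v)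
    (h : IsReducedWord (R ++ u)) :
    insW R u = insW R v ∧ CKEquiv (bumpW R u) (bumpW R v) := by
  induction huv with
  | rel x y hxy =>
    obtain ⟨a, b, t, t', ht, rfl, rfl⟩ := hxy.exists_triple
    have h1 : IsReducedWord (R ++ (a ++ t)) :=
      IsReducedWord.left (b := b) (by simpa using h)
    obtain ⟨e1, e2⟩ := ht.insW (hR.insW a) (isReducedWord_insW_append hR h1)
    simp only [insW_append, bumpW_append, e1, true_and]
    exact (e2.append_left _).append_right _
  | refl x => exact ⟨rfl, CKEquiv.refl _⟩
  | symm x y hxy ih =>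
    obtain ⟨e1, e2⟩ := ih ((CKEquiv.symm (CKEquiv.append_left R hxy)).isReducedWord h)
    exact ⟨e1.symm, e2.symm⟩
  | trans x y z hxy hyz ih ih' =>
    obtain ⟨e1, e2⟩ := ih h
    obtain ⟨e3, e4⟩ := ih' ((CKEquiv.append_left R hxy).isReducedWord h)
    exact ⟨e1.trans e3, e2.trans e4⟩

/-! ### Increasing and decreasing words inserted into a row -/

/-- Strictly decreasing words. -/
abbrev Decr (R : List ℕ) : Prop := R.Pairwise (· > ·)

theorem incr_append_singleton {R : List ℕ} {x : ℕ} :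
    Incr (R ++ [x]) ↔ Incr R ∧ ∀ r ∈ R, r < x := by
  simp [Incr, List.pairwise_append]

theorem rowIns_of_forall_lt {R : List ℕ} {x : ℕ} (h : ∀ r ∈ R, r < x) :
    rowIns R x = R ++ [x] ∧ rowBump R x = [] := by
  induction R with
  | nil => simp [rowIns, rowBump]
  | cons a R ih =>
    have ha := h a (by simp)
    rw [rowIns_of_gt ha, rowBump_of_gt ha]
    obtain ⟨h1, h2⟩ := ih fun r hr => h r (by simp [hr])
    simp [h1, h2]

theorem insW_of_incr_append {R t : List ℕ} (h : Incr (R ++ t)) :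
    insW R t = R ++ t ∧ bumpW R t = [] := by
  induction t generalizing R with
  | nil => simp
  | cons x t ih =>
    have e : R ++ x :: t = R ++ [x] ++ t := by simp
    rw [e] at h ⊢
    obtain ⟨h1, h2⟩ := rowIns_of_forall_lt
      (incr_append_singleton.1 (List.pairwise_append.1 h).1).2
    simpa [h1, h2] using ih h

theorem mem_rowIns_self (R : List ℕ) (x : ℕ) : x ∈ rowIns R x := by
  induction R with
  | nil => simp [rowIns]
  | cons a R ih =>
    simp only [rowIns]
    split_ifs with h1 h2
    · simp
    · simp [h2]
    · simp [ih]

theorem mem_rowIns_of_lt {R : List ℕ} (hR : Incr R) {x y : ℕ} (hx : x ∈ R) (h : x < y) :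
    x ∈ rowIns R y := by
  induction R with
  | nil => simp at hx
  | cons a R ih =>
    obtain ⟨h1, h2⟩ := List.pairwise_cons.1 hR
    have hax : a ≤ x := by
      rcases List.mem_cons.1 hx with rfl | hx
      · exact le_rfl
      · exact (h1 x hx).le
    rw [rowIns_of_gt (by omega)]
    rcases List.mem_cons.1 hx with rfl | hx
    · simp
    · simp [ih h2 hx]

theorem mem_insW_of_forall_lt {R t : List ℕ} (hR : Incr R) {x : ℕ} (hx : x ∈ R)
    (h : ∀ y ∈ t, x < y) : x ∈ insW R t := by
  induction t generalizing R with
  | nil => simpa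
  | cons y t ih =>
    rw [insW_cons]
    exact ih (hR.rowIns y) (mem_rowIns_of_lt hR hx (h y (by simp))) fun z hz => h z (by simp [hz])

theorem subset_insW {R t : List ℕ} (hR : Incr R) (ht : Incr t) : ∀ x ∈ t, x ∈ insW R t := by
  induction t generalizing R with
  | nil => simp
  | cons y t ih =>
    obtain ⟨h1, h2⟩ := List.pairwise_cons.1 ht
    intro x hx
    rw [insW_cons]
    rcases List.mem_cons.1 hx with rfl | hx
    · exact mem_insW_of_forall_lt (hR.rowIns x) (mem_rowIns_self R x) h1
    · exact ih (hR.rowIns y) h2 x hx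

theorem bumpW_incr_aux {R t : List ℕ} {x : ℕ} (hR : Incr R) (ht : Incr (x :: t)) :
    Incr (bumpW R (x :: t)) ∧ (rowBump R x = [] → bumpW (rowIns R x) t = []) ∧
      ∀ y, rowBump R x = [y] → ∀ z ∈ bumpW (rowIns R x) t, y < z := by
  induction t generalizing R x with
  | nil =>
    rcases rowBump_eq_nil_or (R := R) x with e | ⟨y, e, hy⟩ <;> simp [e]
  | cons c t ih =>
    obtain ⟨h1, h2⟩ := List.pairwise_cons.1 ht
    obtain ⟨i1, i2, i3⟩ := ih (hR.rowIns x) h2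
    rcases rowBump_after_smaller hR (h1 c (by simp)) with e | ⟨y, y', e, e', hy⟩
    · have := i2 e
      rcases rowBump_eq_nil_or (R := R) x with e1 | ⟨y, e1, hy⟩ <;> simp [e, e1, this]
    · have h3 : ∀ z ∈ bumpW (rowIns R x) (c :: t), y < z := by
        intro z hz
        rw [bumpW_cons, e'] at hz
        rcases List.mem_cons.1 hz with rfl | hz
        · exact hy
        · exact hy.trans (i3 y' e' z hz)
      refine ⟨?_, by simp [e], fun z hz => ?_⟩
      · rw [bumpW_cons, e]
        exact List.pairwise_cons.2 ⟨h3, i1⟩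
      · rw [e] at hz
        simp only [List.cons.injEq, and_true] at hz
        exact hz ▸ h3

theorem Incr.bumpW {R t : List ℕ} (hR : Incr R) (ht : Incr t) : Incr (bumpW R t) := by
  cases t with
  | nil => simp
  | cons x t => exact (bumpW_incr_aux hR ht).1

theorem length_rowBump_le (R : List ℕ) (x : ℕ) : (rowBump R x).length ≤ 1 := by
  rcases rowBump_eq_nil_or (R := R) x with e | ⟨y, e, -⟩ <;> simp [e]

theorem length_le_insW (R t : List ℕ) : R.length ≤ (insW R t).length := by
  induction t generalizing R with
  | nil => simp
  | cons x t ih =>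
    have h1 := length_rowIns_add R x
    have h2 := length_rowBump_le R x
    have h3 := ih (rowIns R x)
    rw [insW_cons]
    omega

theorem insW_decr_aux {R t : List ℕ} {x : ℕ} (ht : Decr (x :: t)) :
    (insW (rowIns R x) t).length = (rowIns R x).length ∧ Decr (bumpW (rowIns R x) t) ∧
      ∀ z ∈ bumpW (rowIns R x) t, z ≤ x := by
  induction t generalizing R x with
  | nil => simp
  | cons c t ih =>
    obtain ⟨h1, h2⟩ := List.pairwise_cons.1 ht
    obtain ⟨y, e, hy⟩ := rowBump_after_larger R (h1 c (by simp))
    obtain ⟨i1, i2, i3⟩ := ih (R := rowIns R x) h2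
    have h3 := length_rowIns_add (rowIns R x) c
    have h4 : c < y := by
      rcases rowBump_eq_nil_or (R := rowIns R x) c with e3 | ⟨z, e3, hz⟩
      · simp [e3] at e
      · rw [e3] at e; simp at e; omega
    rw [e] at h3
    simp only [insW_cons, bumpW_cons, e, i1]
    refine ⟨by simpa using h3, List.pairwise_cons.2 ⟨fun z hz => ?_, i2⟩, fun z hz => ?_⟩
    · have := i3 z hz; omega
    · rcases List.mem_cons.1 hz with rfl | hz
      · exact hy
      · have := i3 z hz; omega

theorem insW_decr (R : List ℕ) {t : List ℕ} (ht : Decr t) :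
    (insW R t).length ≤ R.length + 1 ∧ Decr (bumpW R t) := by
  cases t with
  | nil => simp
  | cons x t =>
    obtain ⟨i1, i2, i3⟩ := insW_decr_aux (R := R) ht
    have h1 := length_rowIns_add R x
    rw [insW_cons, bumpW_cons]
    refine ⟨by omega, ?_⟩
    rcases rowBump_eq_nil_or (R := R) x with e | ⟨y, e, hy⟩
    · simpa [e] using i2
    · rw [e]
      exact List.pairwise_cons.2 ⟨fun z hz => by have := i3 z hz; omega, i2⟩

theorem insW_flatten_decr (R : List ℕ) {Ds : List (List ℕ)} (h : ∀ D ∈ Ds, Decr D) :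
    (insW R Ds.flatten).length ≤ R.length + Ds.length ∧
      ∃ Es : List (List ℕ), (∀ E ∈ Es, Decr E) ∧ bumpW R Ds.flatten = Es.flatten ∧
        Es.length = Ds.length := by
  induction Ds generalizing R with
  | nil => exact ⟨by simp, [], by simp, by simp, rfl⟩
  | cons D Ds ih =>
    obtain ⟨h1, h2⟩ := insW_decr R (h D (by simp))
    obtain ⟨h3, Es, h4, h5, h6⟩ := ih (insW R D) fun E hE => h E (by simp [hE])
    refine ⟨by simp; omega, bumpW R D :: Es, ?_, by simp [h5], by simp [h6]⟩
    intro E hE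
    rcases List.mem_cons.1 hE with rfl | hE
    · exact h2
    · exact h4 E hE

/-! ### The rows of a word -/

/-- The first row of the Edelman–Greene tableau of a word. -/
def rowOf (ρ : List ℕ) : List ℕ := insW [] ρ

/-- The word of letters bumped out of the first row of the Edelman–Greene tableau. -/
def restOf (ρ : List ℕ) : List ℕ := bumpW [] ρ

theorem rowOf_append (u v : List ℕ) : rowOf (u ++ v) = insW (rowOf u) v := insW_append _ _ _

theorem restOf_append (u v : List ℕ) : restOf (u ++ v) = restOf u ++ bumpW (rowOf u) v :=
  bumpW_append _ _ _

theorem incr_rowOf (ρ : List ℕ) : Incr (rowOf ρ) := Incr.insW List.Pairwise.nil ρ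

theorem length_rowOf_add (ρ : List ℕ) : (rowOf ρ).length + (restOf ρ).length = ρ.length := by
  have h := length_insW_add [] ρ
  simpa [rowOf, restOf] using h

theorem rowOf_of_incr {t : List ℕ} (ht : Incr t) : rowOf t = t :=
  (insW_of_incr_append (R := []) ht).1

theorem restOf_of_incr {t : List ℕ} (ht : Incr t) : restOf t = [] :=
  (insW_of_incr_append (R := []) ht).2

theorem ckEquiv_restOf_rowOf {ρ : List ℕ} (h : IsReducedWord ρ) :
    CKEquiv ρ (restOf ρ ++ rowOf ρ) := ckEquiv_insW (R := []) List.Pairwise.nil h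

theorem CKEquiv.rowOf_eq {ρ σ : List ℕ} (h : CKEquiv ρ σ) (hρ : IsReducedWord ρ) :
    rowOf ρ = rowOf σ := (h.insW (R := []) List.Pairwise.nil hρ).1

theorem CKEquiv.restOf {ρ σ : List ℕ} (h : CKEquiv ρ σ) (hρ : IsReducedWord ρ) :
    CKEquiv (restOf ρ) (restOf σ) := (h.insW (R := []) List.Pairwise.nil hρ).2

theorem IsReducedWord.restOf {ρ : List ℕ} (h : IsReducedWord ρ) : IsReducedWord (restOf ρ) :=
  ((ckEquiv_restOf_rowOf h).isReducedWord h).left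

theorem rowOf_ne_nil {ρ : List ℕ} (h : ρ ≠ []) : rowOf ρ ≠ [] := by
  cases ρ with
  | nil => exact absurd rfl h
  | cons x ρ =>
    intro e
    have := length_le_insW (rowIns [] x) ρ
    rw [rowOf, insW_cons] at e
    rw [e] at this
    simp [rowIns] at this

theorem length_restOf_lt {ρ : List ℕ} (h : ρ ≠ []) : (restOf ρ).length < ρ.length := by
  have h1 := length_rowOf_add ρ
  have h2 := List.length_pos_of_ne_nil (rowOf_ne_nil h)
  omega

/-! ### Left-justified domination of increasing words -/

/-- The `i`-th letter of the second word exists and is smaller than the `i`-th letter of the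
first word, for every letter of the first word. -/
def LeftDom : List ℕ → List ℕ → Prop
  | [], _ => True
  | _ :: _, [] => False
  | a :: A, w :: W => w < a ∧ LeftDom A W

@[simp] theorem leftDom_nil (W : List ℕ) : LeftDom [] W := by simp [LeftDom]

@[simp] theorem not_leftDom_cons_nil (a : ℕ) (A : List ℕ) : ¬ LeftDom (a :: A) [] := by
  simp [LeftDom]

@[simp] theorem leftDom_cons_cons (a w : ℕ) (A W : List ℕ) :
    LeftDom (a :: A) (w :: W) ↔ w < a ∧ LeftDom A W := by
  simp [LeftDom]

theorem LeftDom.length_le {A W : List ℕ} (h : LeftDom A W) : A.length ≤ W.length := by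
  induction A generalizing W with
  | nil => simp
  | cons a A ih =>
    cases W with
    | nil => simp at h
    | cons w W => simpa using ih (by simpa using ((leftDom_cons_cons _ _ _ _).1 h).2)

theorem LeftDom.append_right {A W : List ℕ} (h : LeftDom A W) (X : List ℕ) :
    LeftDom A (W ++ X) := by
  induction A generalizing W with
  | nil => simp
  | cons a A ih =>
    cases W with
    | nil => simp at h
    | cons w W =>
      rw [leftDom_cons_cons] at h
      rw [List.cons_append, leftDom_cons_cons]
      exact ⟨h.1, ih h.2⟩

theorem LeftDom.snoc_left {A W : List ℕ} {a : ℕ} (h : LeftDom A W) (hl : A.length < W.length)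
    (ha : ∀ w ∈ W, w < a) : LeftDom (A ++ [a]) W := by
  induction A generalizing W with
  | nil =>
    cases W with
    | nil => simp at hl
    | cons w W => simp [ha w (by simp)]
  | cons b A ih =>
    cases W with
    | nil => simp at h
    | cons w W =>
      rw [leftDom_cons_cons] at h
      rw [List.cons_append, leftDom_cons_cons]
      exact ⟨h.1, ih h.2 (by simpa using hl) fun x hx => ha x (by simp [hx])⟩

theorem LeftDom.cons_right {A W : List ℕ} {w : ℕ} (hW : Incr (w :: W)) (h : LeftDom A W) :
    LeftDom A (w :: W) := by
  induction A generalizing W w with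
  | nil => simp
  | cons a A ih =>
    cases W with
    | nil => simp at h
    | cons v W =>
      obtain ⟨h1, h2⟩ := List.pairwise_cons.1 hW
      rw [leftDom_cons_cons] at h ⊢
      exact ⟨(h1 v (by simp)).trans h.1, ih h2 h.2⟩

theorem LeftDom.of_sublist {A Z T : List ℕ} (hT : Incr T) (hA : A.Sublist Z) (h : LeftDom Z T) :
    LeftDom A T := by
  induction hA generalizing T with
  | slnil => simp
  | @cons A Z z _ ih =>
    cases T with
    | nil => simp at h
    | cons t T =>
      rw [leftDom_cons_cons] at h
      exact (ih (List.pairwise_cons.1 hT).2 h.2).cons_right hT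
  | @cons_cons A Z z _ ih =>
    cases T with
    | nil => simp at h
    | cons t T =>
      rw [leftDom_cons_cons] at h ⊢
      exact ⟨h.1, ih (List.pairwise_cons.1 hT).2 h.2⟩

theorem LeftDom.insW {A T : List ℕ} (hT : Incr T) (h : LeftDom A T) :
    insW A T = T ∧ bumpW A T = A := by
  induction A generalizing T with
  | nil => exact insW_of_incr_append (R := []) hT
  | cons a A ih =>
    cases T with
    | nil => simp at h
    | cons t T =>
      obtain ⟨h1, h2⟩ := List.pairwise_cons.1 hT
      rw [leftDom_cons_cons] at h
      obtain ⟨h3, h4⟩ := ih h2 h.2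
      rw [insW_cons, bumpW_cons, rowIns_of_lt h.1, rowBump_of_lt h.1, insW_cons_of_lt h1,
        bumpW_cons_of_lt h1, h3, h4]
      simp

theorem leftDom_of_insW_eq {Z T : List ℕ} (hZ : Incr Z) (hT : Incr T)
    (h : IsReducedWord (Z ++ T)) (e : insW Z T = T) : LeftDom Z T := by
  induction T generalizing Z with
  | nil =>
    rw [insW_nil] at e
    simp [e]
  | cons t T ih =>
    cases Z with
    | nil => simp
    | cons z Z =>
      obtain ⟨h1, h2⟩ := List.pairwise_cons.1 hT
      obtain ⟨h3, h4⟩ := List.pairwise_cons.1 hZ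
      have hr := isReducedWord_rowIns_append hZ h
      rcases lt_trichotomy t z with hlt | rfl | hgt
      · rw [insW_cons, rowIns_of_lt hlt, insW_cons_of_lt h1] at e
        rw [rowIns_of_lt hlt] at hr
        exact (leftDom_cons_cons _ _ _ _).2
          ⟨hlt, ih h4 h2 (IsReducedWord.right (a := [t]) hr) (by simpa using e)⟩
      · obtain ⟨R', rfl⟩ := exists_tail_eq_succ_cons hZ (IsReducedWord.left (b := T) (by simpa using h))
        rw [insW_cons, rowIns_of_eq, insW_cons_of_lt h1] at e
        rw [rowIns_of_eq] at hr
        have := ih h4 h2 (IsReducedWord.right (a := [t]) hr) (by simpa using e)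
        cases T with
        | nil => simp at this
        | cons s T =>
          rw [leftDom_cons_cons] at this
          have := h1 s (by simp)
          omega
      · have h5 : ∀ x ∈ t :: T, z < x := by
          intro x hx
          rcases List.mem_cons.1 hx with rfl | hx
          · exact hgt
          · exact hgt.trans (h1 x hx)
        rw [insW_cons_of_lt h5] at e
        simp at e
        omega

theorem leftDom_rowOf_restOf {ρ : List ℕ} (h : IsReducedWord ρ) :
    LeftDom (rowOf (restOf ρ)) (rowOf ρ) := by
  have h1 := ckEquiv_restOf_rowOf h
  have h2 := h1.isReducedWord h
  have e := (h1.rowOf_eq h).symm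
  rw [rowOf_append] at e
  exact leftDom_of_insW_eq (incr_rowOf _) (incr_rowOf _)
    (isReducedWord_insW_append (R := []) List.Pairwise.nil h2) e

/-! ### Right-justified domination of increasing words -/

/-- The `i`-th letter from the right of the first word exists and is larger than the `i`-th
letter from the right of the second word, for every letter of the second word. -/
inductive RightDom : List ℕ → List ℕ → Prop
  | nil (A : List ℕ) : RightDom A []
  | snoc {A W : List ℕ} {a w : ℕ} (h : RightDom A W) (hw : w < a) :
      RightDom (A ++ [a]) (W ++ [w])

theorem RightDom.snoc_left {A W : List ℕ} {x : ℕ} (h : RightDom A W) (hA : Incr (A ++ [x])) :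
    RightDom (A ++ [x]) W := by
  induction h generalizing x with
  | nil A => exact .nil _
  | @snoc A W a w _ hw ih =>
    rw [incr_append_singleton] at hA
    exact .snoc (ih hA.1) (hw.trans (hA.2 a (by simp)))

theorem RightDom.ckEquiv_slide {A W : List ℕ} (h : RightDom A W) (hW : Incr W) {X : List ℕ}
    (hX : Incr (A ++ X)) : CKEquiv (A ++ W ++ X) (A ++ X ++ W) := by
  induction h generalizing X with
  | nil A => exact CKEquiv.of_eq (by simp)
  | @snoc A W a w _ hw ih =>
    have e : A ++ [a] ++ X = A ++ (a :: X) := by simp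
    rw [e] at hX
    have h1 := (ckEquiv_slide_large hw hW).append_append A X
    have h2 := (ckEquiv_slide_small hw (List.pairwise_append.1 hX).2.1).append_left (A ++ W)
    have h3 := (ih (incr_append_singleton.1 hW).1 hX).append_right [w]
    simp only [List.append_assoc, List.cons_append, List.nil_append] at h1 h2 h3 ⊢
    exact h1.trans (h2.trans h3)

theorem exists_singletons (A : List ℕ) : ∃ Ds : List (List ℕ), (∀ D ∈ Ds, Decr D) ∧
    A = Ds.flatten ∧ Ds.length = A.length := by
  refine ⟨A.map fun a => [a], ?_, ?_, by simp⟩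
  · intro D hD
    obtain ⟨a, -, rfl⟩ := List.mem_map.1 hD
    simp [Decr]
  · induction A with
    | nil => rfl
    | cons a A ih => simpa using ih

theorem RightDom.exists_columns {A W : List ℕ} (h : RightDom A W) (hW : Incr W) :
    ∃ Ds : List (List ℕ), (∀ D ∈ Ds, Decr D) ∧ CKEquiv (A ++ W) Ds.flatten ∧
      Ds.length = A.length := by
  induction h with
  | nil A =>
    obtain ⟨Ds, h1, h2, h3⟩ := exists_singletons A
    exact ⟨Ds, h1, CKEquiv.of_eq (by simpa using h2), h3⟩
  | @snoc A W a w _ hw ih =>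
    obtain ⟨Ds, h1, h2, h3⟩ := ih (incr_append_singleton.1 hW).1
    refine ⟨Ds ++ [[a, w]], ?_, ?_, by simp [h3]⟩
    · intro D hD
      rcases List.mem_append.1 hD with hD | hD
      · exact h1 D hD
      · obtain rfl := List.mem_singleton.1 hD
        simp [Decr, hw]
    · have h4 := (ckEquiv_slide_large hw hW).append_left A
      have h5 := h2.append_right [a, w]
      simp only [List.append_assoc, List.cons_append, List.nil_append] at h4 h5 ⊢
      exact h4.trans (h5.trans (CKEquiv.of_eq (by simp)))

theorem LeftDom.ckEquiv_cons_cons {a w : ℕ} {A W : List ℕ} (hA : Incr (a :: A)) (hw : w < a) :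
    CKEquiv ((a :: A) ++ (w :: W)) (a :: w :: (A ++ W)) := by
  have := (ckEquiv_slide_small hw hA).symm.append_right W
  simpa using this

theorem LeftDom.exists_columns {A W : List ℕ} (h : LeftDom A W) (hA : Incr A) :
    ∃ Ds : List (List ℕ), (∀ D ∈ Ds, Decr D) ∧ CKEquiv (A ++ W) Ds.flatten ∧
      Ds.length = W.length := by
  induction A generalizing W with
  | nil =>
    obtain ⟨Ds, h1, h2, h3⟩ := exists_singletons W
    exact ⟨Ds, h1, CKEquiv.of_eq (by simpa using h2), h3⟩
  | cons a A ih =>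
    cases W with
    | nil => simp at h
    | cons w W =>
      rw [leftDom_cons_cons] at h
      obtain ⟨Ds, h1, h2, h3⟩ := ih h.2 (List.pairwise_cons.1 hA).2
      refine ⟨[a, w] :: Ds, ?_, ?_, by simp [h3]⟩
      · intro D hD
        rcases List.mem_cons.1 hD with rfl | hD
        · simpa [Decr] using h.1
        · exact h1 D hD
      · exact (LeftDom.ckEquiv_cons_cons hA h.1).trans (h2.append_left [a, w])

/-! ### Straightening a product of two increasing words -/

theorem incr_eq_append_of_mem {W : List ℕ} {a : ℕ} (hW : Incr W) (ha : a ∈ W)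
    (h : ∀ w ∈ W, w ≤ a) : ∃ W', W = W' ++ [a] := by
  induction W using List.reverseRecOn with
  | nil => simp at ha
  | append_singleton W x _ =>
    refine ⟨W, ?_⟩
    have h1 := h x (by simp)
    rcases List.mem_append.1 ha with h2 | h2
    · have := (incr_append_singleton.1 hW).2 a h2
      omega
    · rw [List.mem_singleton.1 h2]

theorem exists_straightening {i : ℕ} {A W : List ℕ} (hA : Incr A) (hW : Incr W)
    (hi : ∀ a ∈ A, i < a) (h : IsReducedWord (A ++ W)) :
    ∃ A' W', Incr A' ∧ Incr W' ∧ (∀ w ∈ W', w ∈ W) ∧ (∀ a ∈ A', i < a) ∧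
      CKEquiv (A ++ W) (A' ++ W') ∧ A.length ≤ A'.length ∧
      (RightDom A' W' ∨ (LeftDom A' W' ∧ A'.length < W'.length)) := by
  induction A using List.reverseRecOn generalizing W with
  | nil =>
    refine ⟨[], W, hA, hW, fun _ h => h, hi, CKEquiv.refl _, le_rfl, ?_⟩
    cases W with
    | nil => exact Or.inl (.nil _)
    | cons w W => exact Or.inr (by simp)
  | append_singleton A a ihA =>
    induction W using List.reverseRecOn with
    | nil => exact ⟨A ++ [a], [], hA, hW, fun _ h => h, hi, CKEquiv.refl _, le_rfl, Or.inl (.nil _)⟩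
    | append_singleton W x ihW =>
      have hA' := incr_append_singleton.1 hA
      have hW' := incr_append_singleton.1 hW
      have hi' : ∀ b ∈ A, i < b := fun b hb => hi b (by simp [hb])
      have hia : i < a := hi a (by simp)
      rcases lt_trichotomy x a with hx | rfl | hx
      · have h1 := (ckEquiv_slide_large hx hW).append_left A
        have e1 : A ++ [a] ++ (W ++ [x]) = A ++ (a :: (W ++ [x])) := by simp
        have e2 : A ++ (W ++ [a, x]) = A ++ W ++ [a, x] := by simp
        rw [e2] at h1
        rw [e1] at h ⊢
        have h2 := (h1.isReducedWord h).left
        obtain ⟨B, V, hB, hV, hVW, hBi, hBV, hl, hdom⟩ := ihA hA'.1 hW'.1 hi' h2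
        have hBa : ∀ b ∈ B, b < a := by
          intro b hb
          have := (hBV.mem_iff b).2 (by simp [hb])
          rcases List.mem_append.1 this with hb | hb
          · exact hA'.2 b hb
          · exact (hW'.2 b hb).trans hx
        have hVx : ∀ v ∈ V, v < x := fun v hv => hW'.2 v (hVW v hv)
        have hVx' := incr_append_singleton.2 ⟨hV, hVx⟩
        refine ⟨B ++ [a], V ++ [x], incr_append_singleton.2 ⟨hB, hBa⟩, hVx', ?_, ?_, ?_, ?_, ?_⟩
        · intro w hw
          rcases List.mem_append.1 hw with hw | hw
          · simp [hVW w hw]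
          · simp [List.mem_singleton.1 hw]
        · intro b hb
          rcases List.mem_append.1 hb with hb | hb
          · exact hBi b hb
          · rw [List.mem_singleton.1 hb]; exact hia
        · refine h1.trans ((hBV.append_right [a, x]).trans ?_)
          have := (ckEquiv_slide_large hx hVx').symm.append_left B
          simpa using this
        · simpa using hl
        · rcases hdom with hd | ⟨hd, hlt⟩
          · exact Or.inl (.snoc hd hx)
          · exact Or.inr ⟨(hd.snoc_left hlt fun v hv => (hVx v hv).trans hx).append_right _,
              by simpa using hlt⟩
      · obtain ⟨w, hw, -, hw2⟩ := IsReducedWord.exists_near (x := x) (W := W)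
          (IsReducedWord.right (a := A) (by simpa using h))
        have hwx := hW'.2 w hw
        obtain rfl : x = w + 1 := by omega
        obtain ⟨W, rfl⟩ := incr_eq_append_of_mem hW'.1 hw fun v hv => by
          have := hW'.2 v hv; omega
        have hWw := incr_append_singleton.1 hW'.1
        have h1 : CKEquiv (A ++ [w + 1] ++ (W ++ [w] ++ [w + 1]))
            (A ++ (W ++ [w]) ++ [w + 1, w]) := by
          have s1 := (ckEquiv_slide_large (Nat.lt_succ_self w) hW'.1).append_append A [w + 1]
          have s2 := (ckEquiv_braid w []).symm.append_left (A ++ W)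
          simp only [List.append_assoc, List.cons_append, List.nil_append] at s1 s2 ⊢
          exact s1.trans s2
        have h2 := h1.isReducedWord h
        obtain ⟨B, V, hB, hV, hVW, hBi, hBV, hl, hdom⟩ := ihA hA'.1 hW'.1 hi' h2.left
        have hBa : ∀ b ∈ B, b < w + 1 := by
          intro b hb
          have := (hBV.mem_iff b).2 (by simp [hb])
          rcases List.mem_append.1 this with hb | hb
          · exact hA'.2 b hb
          · exact hW'.2 b hb
        have hBa' := incr_append_singleton.2 ⟨hB, hBa⟩
        have hVw : ∀ v ∈ V, v < w + 1 := fun v hv => hW'.2 v (hVW v hv)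
        have hBi' : ∀ b ∈ B ++ [w + 1], i < b := by
          intro b hb
          rcases List.mem_append.1 hb with hb | hb
          · exact hBi b hb
          · rw [List.mem_singleton.1 hb]; exact hia
        have h3 := h1.trans (hBV.append_right [w + 1, w])
        have h4 := h3.isReducedWord h
        by_cases hwV : w ∈ V
        · rcases hdom with hd | ⟨hd, hlt⟩
          · exfalso
            obtain ⟨V, rfl⟩ := incr_eq_append_of_mem hV hwV fun v hv => by
              have := hVw v hv; omega
            have s1 := (hd.ckEquiv_slide hV hBa').append_right [w]
            have h5 : IsReducedWord ((B ++ [w + 1] ++ V) ++ w :: w :: []) := by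
              have := s1.isReducedWord (by simpa using h4)
              simpa using this
            exact h5.ne_of_adjacent rfl
          · refine ⟨B ++ [w + 1], V ++ [w + 1], hBa', incr_append_singleton.2 ⟨hV, hVw⟩, ?_,
              hBi', ?_, by simpa using hl, Or.inr ⟨(hd.snoc_left hlt hVw).append_right _,
              by simpa using hlt⟩⟩
            · intro v hv
              rcases List.mem_append.1 hv with hv | hv
              · exact List.mem_append_left _ (hVW v hv)
              · exact List.mem_append_right _ hv
            · obtain ⟨V, rfl⟩ := incr_eq_append_of_mem hV hwV fun v hv => by
                have := hVw v hv; omega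
              refine h3.trans ?_
              have s1 := (ckEquiv_slide_large (Nat.lt_succ_self w) hV).symm.append_append B [w + 1]
              have s2 := (ckEquiv_braid w []).append_left (B ++ V)
              simp only [List.append_assoc, List.cons_append, List.nil_append] at s1 s2 ⊢
              exact s2.trans s1
        · have hVw' : ∀ v ∈ V, v < w := by
            intro v hv
            have h5 := hVw v hv
            have h6 : v ≠ w := fun h => hwV (h ▸ hv)
            omega
          have hVw2 := incr_append_singleton.2 ⟨hV, hVw'⟩
          refine ⟨B ++ [w + 1], V ++ [w], hBa', hVw2, ?_, hBi', ?_, by simpa using hl, ?_⟩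
          · intro v hv
            rcases List.mem_append.1 hv with hv | hv
            · exact List.mem_append_left _ (hVW v hv)
            · simp [List.mem_singleton.1 hv]
          · refine h3.trans ?_
            have := (ckEquiv_slide_large (Nat.lt_succ_self w) hVw2).symm.append_left B
            simpa using this
          · rcases hdom with hd | ⟨hd, hlt⟩
            · exact Or.inl (.snoc hd (Nat.lt_succ_self w))
            · exact Or.inr ⟨(hd.snoc_left hlt hVw).append_right _, by simpa using hlt⟩
      · have e1 : A ++ [a] ++ (W ++ [x]) = A ++ [a] ++ W ++ [x] := by simp
        rw [e1] at h ⊢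
        obtain ⟨B, V, hB, hV, hVW, hBi, hBV, hl, hdom⟩ := ihW hW'.1 h.left
        have hBx : ∀ b ∈ B, b < x := by
          intro b hb
          have := (hBV.mem_iff b).2 (by simp [hb])
          rcases List.mem_append.1 this with hb | hb
          · rcases List.mem_append.1 hb with hb | hb
            · exact (hA'.2 b hb).trans hx
            · rw [List.mem_singleton.1 hb]; exact hx
          · exact hW'.2 b hb
        have hVx : ∀ v ∈ V, v < x := fun v hv => hW'.2 v (hVW v hv)
        have hBx' := incr_append_singleton.2 ⟨hB, hBx⟩
        rcases hdom with hd | ⟨hd, hlt⟩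
        · refine ⟨B ++ [x], V, hBx', hV, fun v hv => by simp [hVW v hv], ?_,
            (hBV.append_right [x]).trans (hd.ckEquiv_slide hV hBx'), ?_, Or.inl (hd.snoc_left hBx')⟩
          · intro b hb
            rcases List.mem_append.1 hb with hb | hb
            · exact hBi b hb
            · rw [List.mem_singleton.1 hb]; omega
          · simp at hl ⊢; omega
        · refine ⟨B, V ++ [x], hB, incr_append_singleton.2 ⟨hV, hVx⟩, ?_, hBi,
            (hBV.append_right [x]).trans (CKEquiv.of_eq (by simp)), hl,
            Or.inr ⟨hd.append_right _, by simp; omega⟩⟩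
          intro v hv
          rcases List.mem_append.1 hv with hv | hv
          · exact List.mem_append_left _ (hVW v hv)
          · exact List.mem_append_right _ hv

theorem exists_kick {Q : List ℕ} {z : ℕ} (hQ : Incr Q) (h : IsReducedWord (z :: Q))
    (hz : ∃ q ∈ Q, q < z) :
    ∃ Q' y, CKEquiv (z :: Q) (Q' ++ [y]) ∧ Incr Q' ∧ Q'.length = Q.length ∧ y ∈ Q ∧ y < z ∧
      ∀ e ∈ Q', e + 1 < z → e < y := by
  induction Q with
  | nil => simp at hz
  | cons q Q ih =>
    obtain ⟨h1, h2⟩ := List.pairwise_cons.1 hQ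
    have hq : q < z := by
      obtain ⟨p, hp, hpz⟩ := hz
      rcases List.mem_cons.1 hp with rfl | hp
      · exact hpz
      · exact (h1 p hp).trans hpz
    by_cases hz' : ∃ p ∈ Q, p < z
    · have h3 : CKEquiv (z :: q :: Q) (q :: z :: Q) := by
        cases Q with
        | nil => simp at hz'
        | cons p Q =>
          have hp : p < z := by
            obtain ⟨p', hp', hpz⟩ := hz'
            rcases List.mem_cons.1 hp' with rfl | hp'
            · exact hpz
            · exact ((List.pairwise_cons.1 h2).1 p' hp').trans hpz
          exact ckEquiv_high_low_mid (h1 p (by simp)) hp Q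
      obtain ⟨Q', y, i1, i2, i3, i4, i5, i6⟩ :=
        ih h2 (IsReducedWord.right (a := [q]) (h3.isReducedWord h)) hz'
      refine ⟨q :: Q', y, h3.trans (i1.cons q), List.pairwise_cons.2 ⟨fun e he => ?_, i2⟩,
        by simp [i3], by simp [i4], i5, fun e he hez => ?_⟩
      · have := (i1.mem_iff e).2 (by simp [he])
        rcases List.mem_cons.1 this with rfl | this
        · exact hq
        · exact h1 e this
      · rcases List.mem_cons.1 he with rfl | he
        · exact h1 y i4
        · exact i6 e he hez
    · push Not at hz'
      by_cases hzQ : z ∈ Q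
      · cases Q with
        | nil => simp at hzQ
        | cons p Q =>
          obtain rfl : p = z := by
            have h3 := hz' p (by simp)
            rcases List.mem_cons.1 hzQ with h4 | h4
            · exact h4.symm
            · have := (List.pairwise_cons.1 h2).1 z h4
              omega
          obtain ⟨w, hw, -, hw2⟩ := IsReducedWord.exists_near (x := p) (W := [q])
            (IsReducedWord.left (b := Q) (by simpa using h))
          rw [List.mem_singleton.1 hw] at hw2
          obtain rfl : p = q + 1 := by omega
          refine ⟨q :: (q + 1) :: Q, q, ?_, hQ, rfl, by simp, hq, ?_⟩
          · exact (ckEquiv_braid q Q).symm.trans ((ckEquiv_slide_small hq h2).cons q)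
          · intro e he heq
            omega
      · have h3 : ∀ p ∈ Q, z < p := fun p hp =>
          lt_of_le_of_ne (hz' p hp) fun e => hzQ (e ▸ hp)
        have h4 : Incr (z :: Q) := List.pairwise_cons.2 ⟨h3, h2⟩
        refine ⟨z :: Q, q, ckEquiv_slide_small hq h4, h4, rfl, by simp, hq, fun e he hez => ?_⟩
        rcases List.mem_cons.1 he with rfl | he
        · omega
        · have := h3 e he; omega

theorem LeftDom.exists_pass {Z R : List ℕ} (h : LeftDom Z R) (hZ : Incr Z) (hR : Incr R)
    (hr : IsReducedWord (Z ++ R)) :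
    ∃ R' Y, CKEquiv (Z ++ R) (R' ++ Y) ∧ Incr R' ∧ Incr Y ∧ R'.length = R.length ∧
      Y.length = Z.length ∧
      ∀ z ∈ Z.head?, ∀ y ∈ Y.head?, ∀ e ∈ R', e + 1 < z → e < y := by
  induction Z generalizing R with
  | nil => exact ⟨R, [], CKEquiv.of_eq (by simp), hR, List.Pairwise.nil, rfl, rfl, by simp⟩
  | cons z Z ih =>
    cases R with
    | nil => simp at h
    | cons r R =>
      rw [leftDom_cons_cons] at h
      obtain ⟨hz, hZ'⟩ := List.pairwise_cons.1 hZ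
      obtain ⟨hrR, hR'⟩ := List.pairwise_cons.1 hR
      have h1 := LeftDom.ckEquiv_cons_cons (W := R) hZ h.1
      have h2 := h1.isReducedWord hr
      obtain ⟨R1, Y1, i1, i2, i3, i4, i5, i6⟩ :=
        ih h.2 hZ' hR' (IsReducedWord.right (a := [z, r]) h2)
      have hgt : ∀ e ∈ R1 ++ Y1, r < e := by
        intro e he
        rcases List.mem_append.1 ((i1.mem_iff e).2 he) with he | he
        · exact h.1.trans (hz e he)
        · exact hrR e he
      have hQ : Incr (r :: R1) :=
        List.pairwise_cons.2 ⟨fun e he => hgt e (List.mem_append_left _ he), i2⟩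
      have h3 := h1.trans (i1.append_left [z, r])
      have h4 := h3.isReducedWord hr
      obtain ⟨Q', y, k1, k2, k3, k4, k5, k6⟩ := exists_kick hQ
        (IsReducedWord.left (b := Y1) (by simpa using h4)) ⟨r, by simp, h.1⟩
      refine ⟨Q', y :: Y1, ?_, k2, List.pairwise_cons.2 ⟨?_, i3⟩, by simp [k3, i4],
        by simp [i5], ?_⟩
      · refine h3.trans ?_
        have := k1.append_right Y1
        simpa using this
      · intro e he
        rcases List.mem_cons.1 k4 with rfl | hy
        · exact hgt e (List.mem_append_right _ he)
        · cases Y1 with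
          | nil => simp at he
          | cons y1 Y1 =>
            cases Z with
            | nil => simp at i5
            | cons z1 Z =>
              have h5 := hz z1 (by simp)
              have h6 := i6 z1 (by simp) y1 (by simp) y hy (by omega)
              rcases List.mem_cons.1 he with rfl | he
              · exact h6
              · exact h6.trans ((List.pairwise_cons.1 i3).1 e he)
      · intro z' hz' y' hy' e he hez
        simp only [List.head?_cons, Option.mem_def, Option.some.injEq] at hz' hy'
        subst hz' hy'
        exact k6 e he hez

/-! ### Shapes of insertion tableaux -/

/-- The length of the `j`-th row of the Edelman–Greene insertion tableau of a word. -/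
def rowLen : ℕ → List ℕ → ℕ
  | 0, ρ => (rowOf ρ).length
  | j + 1, ρ => rowLen j (restOf ρ)

theorem CKEquiv.rowLen_eq {ρ σ : List ℕ} (h : CKEquiv ρ σ) (hρ : IsReducedWord ρ) (j : ℕ) :
    rowLen j ρ = rowLen j σ := by
  induction j generalizing ρ σ with
  | zero => simp only [rowLen, h.rowOf_eq hρ]
  | succ j ih => exact ih (h.restOf hρ) hρ.restOf

theorem sublist_of_subset_of_incr {A B : List ℕ} (hA : Incr A) (hB : Incr B)
    (h : ∀ x ∈ A, x ∈ B) : A.Sublist B := by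
  have hnd : A.Nodup := hA.imp fun h => ne_of_lt h
  exact List.sublist_of_subperm_of_pairwise (hnd.subperm h) hA hB

/-- Every increasing word that ends a word equivalent to `U` straightens, when followed by `W`,
into at most `max |A| |W|` decreasing words. -/
def Straightens (U W : List ℕ) : Prop :=
  ∀ V A, CKEquiv (V ++ A) U → Incr A → ∃ Ds : List (List ℕ), (∀ D ∈ Ds, Decr D) ∧
    CKEquiv (A ++ W) Ds.flatten ∧ Ds.length ≤ max A.length W.length

theorem Straightens.length_rowOf_append_le {U W : List ℕ} (h : Straightens U W)
    (hr : IsReducedWord (U ++ W)) :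
    (insW (rowOf U) W).length ≤ max (rowOf U).length W.length := by
  have hU := ckEquiv_restOf_rowOf hr.left
  obtain ⟨Ds, h1, h2, h3⟩ := h _ _ hU.symm (incr_rowOf U)
  have hr' : IsReducedWord (rowOf U ++ W) := by
    have := (hU.append_right W).isReducedWord hr
    rw [List.append_assoc] at this
    exact this.right
  have e := h2.rowOf_eq hr'
  rw [rowOf_append, rowOf_of_incr (incr_rowOf U)] at e
  rw [e]
  have := (insW_flatten_decr [] h1).1
  simp only [List.length_nil, Nat.zero_add] at this
  exact this.trans h3

theorem Straightens.bump {U W : List ℕ} (h : Straightens U W) (hr : IsReducedWord (U ++ W))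
    (hlen : (bumpW (rowOf U) W).length = W.length) :
    Straightens (restOf U) (bumpW (rowOf U) W) := by
  intro V A hVA hA
  have hU := ckEquiv_restOf_rowOf hr.left
  have h1 : CKEquiv (V ++ A ++ rowOf U) U := (hVA.append_right _).trans hU.symm
  have hsub : A.Sublist (rowOf (restOf U)) := by
    rw [← hVA.rowOf_eq (hVA.symm.isReducedWord hr.left.restOf), rowOf_append]
    exact sublist_of_subset_of_incr hA ((incr_rowOf V).insW A) (subset_insW (incr_rowOf V) hA)
  have hdom := (leftDom_rowOf_restOf hr.left).of_sublist (incr_rowOf U) hsub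
  have hrA : IsReducedWord (A ++ rowOf U ++ W) := by
    have := (h1.symm.append_right W).isReducedWord hr
    simp only [List.append_assoc] at this ⊢
    exact this.right
  obtain ⟨T, B, h2, hT, hB, -, hBA, -⟩ := hdom.exists_pass hA (incr_rowOf U) hrA.left
  have h3 : CKEquiv (V ++ T ++ B) U := by
    have := h2.symm.append_left V
    simp only [← List.append_assoc] at this
    exact this.trans h1
  obtain ⟨Ds, hD, h4, h5⟩ := h _ _ h3 hB
  obtain ⟨-, Es, hE, e1, e2⟩ := insW_flatten_decr T hD
  have h6 : CKEquiv (A ++ rowOf U ++ W) (T ++ Ds.flatten) := by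
    have := (h2.append_right W).trans ((CKEquiv.of_eq (List.append_assoc _ _ _)).trans
      (h4.append_left T))
    exact this
  have h7 := h6.restOf hrA
  obtain ⟨e3, e4⟩ := hdom.insW (incr_rowOf U)
  rw [restOf_append, restOf_append, restOf_append, rowOf_append, rowOf_of_incr hA,
    restOf_of_incr hA, rowOf_of_incr hT, restOf_of_incr hT, e3, e4, e1] at h7
  exact ⟨Es, hE, h7, by rw [e2, hlen, ← hBA]; exact h5⟩

theorem rowLen_append_eq {U U' W W' : List ℕ} (hU : ∀ j, rowLen j U = rowLen j U')
    (hl : W.length = W'.length) (hW : Incr W) (hW' : Incr W')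
    (hr : IsReducedWord (U ++ W)) (hr' : IsReducedWord (U' ++ W'))
    (h : Straightens U W) (h' : Straightens U' W') (j : ℕ) :
    rowLen j (U ++ W) = rowLen j (U' ++ W') := by
  have key : ∀ {U W : List ℕ}, Incr W → IsReducedWord (U ++ W) → Straightens U W →
      (insW (rowOf U) W).length = max (rowOf U).length W.length ∧
      ((rowOf U).length < W.length → bumpW (rowOf U) W = rowOf U) := by
    intro U W hW hr h
    have h1 := h.length_rowOf_append_le hr
    have h2 := length_le_insW (rowOf U) W
    have hs := sublist_of_subset_of_incr hW ((incr_rowOf U).insW W) (subset_insW (incr_rowOf U) hW)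
    refine ⟨le_antisymm h1 (max_le h2 hs.length_le), fun hlt => ?_⟩
    have e : W = insW (rowOf U) W := hs.eq_of_length_le (by omega)
    have hr'' : IsReducedWord (rowOf U ++ W) := by
      have := ((ckEquiv_restOf_rowOf hr.left).append_right W).isReducedWord hr
      rw [List.append_assoc] at this
      exact this.right
    exact ((leftDom_of_insW_eq (incr_rowOf U) hW hr'' e.symm).insW hW).2
  have h0 : (rowOf U).length = (rowOf U').length := hU 0
  obtain ⟨k1, k2⟩ := key hW hr h
  obtain ⟨k1', k2'⟩ := key hW' hr' h'
  induction j generalizing U U' W W' with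
  | zero =>
    simp only [rowLen, rowOf_append]
    rw [k1, k1', h0, hl]
  | succ j ih =>
    simp only [rowLen]
    have hc := (ckEquiv_restOf_rowOf hr.left)
    have hc' := (ckEquiv_restOf_rowOf hr'.left)
    have er := hr.restOf
    have er' := hr'.restOf
    rw [restOf_append] at er er' ⊢
    rw [restOf_append]
    rcases lt_or_ge (rowOf U).length W.length with hlt | hge
    · rw [k2 hlt, k2' (by omega), ← hc.rowLen_eq hr.left, ← hc'.rowLen_eq hr'.left, hU]
    · have hb : (bumpW (rowOf U) W).length = W.length := by
        have := length_insW_add (rowOf U) W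
        omega
      have hb' : (bumpW (rowOf U') W').length = W'.length := by
        have := length_insW_add (rowOf U') W'
        omega
      have s := h.bump hr hb
      have s' := h'.bump hr' hb'
      have i1 := (incr_rowOf U).bumpW hW
      have i2 := (incr_rowOf U').bumpW hW'
      obtain ⟨m1, m2⟩ := key i1 er s
      obtain ⟨m1', m2'⟩ := key i2 er' s'
      exact ih (fun j => hU (j + 1)) (by omega) i1 i2 er er' s s' (hU 1) m1 m2 m1' m2'

/-! ### Words with maximal prefixes -/

/-- The length of the longest prefix of a word consisting of letters larger than `k`. -/
def prefLen (k : ℕ) (σ : List ℕ) : ℕ := (σ.takeWhile (fun x => decide (k < x))).length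

/-- For every `k`, the longest prefix with letters larger than `k` is as long as for every
Coxeter–Knuth equivalent word. -/
def MaxPrefixes (σ : List ℕ) : Prop :=
  ∀ k u v, CKEquiv σ (u ++ v) → (∀ x ∈ u, k < x) → u.length ≤ prefLen k σ

theorem prefLen_append (k : ℕ) (u v : List ℕ) :
    prefLen k u = min (prefLen k (u ++ v)) u.length := by
  have := (List.takeWhile_sublist (l := u) (fun x => decide (k < x))).length_le
  unfold prefLen
  rw [List.takeWhile_append]
  split_ifs with h
  · rw [h]; simp
  · omega

theorem prefLen_append_of_forall_lt {k : ℕ} {u v : List ℕ} (h : ∀ x ∈ u, k < x) :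
    prefLen k (u ++ v) = u.length + prefLen k v := by
  unfold prefLen
  rw [List.takeWhile_append_of_pos (by simpa using h), List.length_append]

theorem MaxPrefixes.left {u v : List ℕ} (h : MaxPrefixes (u ++ v)) : MaxPrefixes u := by
  intro k a b hab ha
  rw [prefLen_append k u v]
  refine le_min (h k a (b ++ v) ?_ ha) ?_
  · simpa using hab.append_right v
  · rw [hab.length_eq]; simp

theorem rowIns_eq_append_of_rowBump_eq_nil {R : List ℕ} {x : ℕ} (h : rowBump R x = []) :
    rowIns R x = R ++ [x] := by
  induction R with
  | nil => simp [rowIns]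
  | cons a R ih =>
    unfold rowBump at h
    unfold rowIns
    split_ifs at h ⊢
    rw [ih h]; simp

theorem incr_append_of_bumpW_eq_nil {R t : List ℕ} (hR : Incr R) (h : bumpW R t = []) :
    Incr (R ++ t) := by
  induction t generalizing R with
  | nil => simpa using hR
  | cons x t ih =>
    rw [bumpW_cons, List.append_eq_nil_iff] at h
    have e := rowIns_eq_append_of_rowBump_eq_nil h.1
    have := ih (hR.rowIns x) h.2
    rw [e] at this
    simpa using this

theorem exists_lt_of_mem_bumpW {R t : List ℕ} {y : ℕ} (h : y ∈ bumpW R t) : ∃ x ∈ t, x < y := by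
  induction t generalizing R with
  | nil => simp at h
  | cons x t ih =>
    rw [bumpW_cons, List.mem_append] at h
    rcases h with h | h
    · rcases rowBump_eq_nil_or (R := R) x with e | ⟨z, e, hz⟩
      · simp [e] at h
      · rw [e, List.mem_singleton] at h
        exact ⟨x, by simp, h ▸ hz⟩
    · obtain ⟨z, hz, hzy⟩ := ih h
      exact ⟨z, by simp [hz], hzy⟩

theorem MaxPrefixes.exists_split {σ : List ℕ} (h : MaxPrefixes σ) (hr : IsReducedWord σ)
    (hne : σ ≠ []) : ∃ i U W, σ = U ++ W ∧ Incr W ∧ W ≠ [] ∧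
      (∀ k, k < i → prefLen k σ = σ.length) ∧ prefLen i σ = U.length ∧ Straightens U W := by
  obtain ⟨i, hi, hmin⟩ := σ.toFinset.exists_min_image id (by simpa using hne)
  simp only [List.mem_toFinset, id] at hi hmin
  obtain ⟨U, W, rfl, hU⟩ := List.eq_append_cons_of_mem hi
  have hUi : ∀ x ∈ U, i < x := fun x hx =>
    lt_of_le_of_ne (hmin x (by simp [hx])) fun e => hU (e ▸ hx)
  have hpi : prefLen i (U ++ i :: W) = U.length := by
    rw [prefLen_append_of_forall_lt hUi]
    simp [prefLen]
  have hW : Incr (i :: W) := by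
    refine incr_append_of_bumpW_eq_nil (R := []) List.Pairwise.nil ?_
    have h1 := (ckEquiv_restOf_rowOf hr.right).append_left U
    rw [← List.append_assoc] at h1
    have h2 := h i _ _ h1 (by
      intro x hx
      rcases List.mem_append.1 hx with hx | hx
      · exact hUi x hx
      · obtain ⟨y, hy, hyx⟩ := exists_lt_of_mem_bumpW hx
        exact (hmin y (by simp [List.mem_cons.1 hy])).trans_lt hyx)
    rw [hpi, List.length_append] at h2
    exact List.length_eq_zero_iff.1 (by simpa [restOf] using h2)
  refine ⟨i, U, i :: W, rfl, hW, by simp, fun k hk => ?_, hpi, fun V A hVA hA => ?_⟩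
  · unfold prefLen
    rw [List.takeWhile_eq_self_iff.2]
    intro x hx
    simpa using hk.trans_le (hmin x hx)
  · have hσ : CKEquiv (U ++ i :: W) (V ++ (A ++ i :: W)) := by
      simpa using hVA.symm.append_right (i :: W)
    have hAi : ∀ a ∈ A, i < a := fun a ha => hUi a ((hVA.mem_iff a).1 (by simp [ha]))
    obtain ⟨A', W', hA', hW', -, hA'i, he, hle, hdom⟩ :=
      exists_straightening hA hW hAi (hσ.isReducedWord hr).right
    have h1 := hσ.trans (he.append_left V)
    rw [← List.append_assoc] at h1
    have h2 := h i _ _ h1 (by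
      intro x hx
      rcases List.mem_append.1 hx with hx | hx
      · exact hUi x ((hVA.mem_iff x).1 (by simp [hx]))
      · exact hA'i x hx)
    have h3 := hVA.length_eq
    have h4 := he.length_eq
    rw [hpi] at h2
    simp only [List.length_append] at h2 h3 h4
    rcases hdom with hd | ⟨hd, -⟩
    · obtain ⟨Ds, d1, d2, d3⟩ := hd.exists_columns hW'
      exact ⟨Ds, d1, he.trans d2, le_max_of_le_left (by omega)⟩
    · obtain ⟨Ds, d1, d2, d3⟩ := hd.exists_columns hA'
      exact ⟨Ds, d1, he.trans d2, le_max_of_le_right (by omega)⟩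

theorem MaxPrefixes.rowLen_eq {σ τ : List ℕ} (hσ : MaxPrefixes σ) (hτ : MaxPrefixes τ)
    (hrσ : IsReducedWord σ) (hrτ : IsReducedWord τ) (hlen : σ.length = τ.length)
    (hpref : ∀ k, prefLen k σ = prefLen k τ) (j : ℕ) : rowLen j σ = rowLen j τ := by
  induction hn : σ.length using Nat.strong_induction_on generalizing σ τ j with
  | _ n ih =>
  subst hn
  by_cases hne : σ = []
  · subst hne
    rw [List.length_eq_zero_iff.1 hlen.symm]
  have hne' : τ ≠ [] := fun e => hne (List.length_eq_zero_iff.1 (by simp [hlen, e]))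
  obtain ⟨i, U, W, rfl, hW, hW0, hk, hi, hs⟩ := hσ.exists_split hrσ hne
  obtain ⟨i', U', W', rfl, hW', hW0', hk', hi', hs'⟩ := hτ.exists_split hrτ hne'
  have p1 := List.length_pos_of_ne_nil hW0
  have p2 := List.length_pos_of_ne_nil hW0'
  simp only [List.length_append] at hlen hk hk'
  have hii : i = i' := by
    rcases lt_trichotomy i i' with h | h | h
    · have := hk' i h
      rw [← hpref, hi] at this
      omega
    · exact h
    · have := hk i' h
      rw [hpref, hi'] at this
      omega
  subst hii
  have hUl : U.length = U'.length := by rw [← hi, ← hi', hpref]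
  refine rowLen_append_eq (fun j => ?_) (by omega) hW hW' hrσ hrτ hs hs' j
  refine ih _ (by simp; omega) hσ.left hτ.left hrσ.left hrτ.left hUl (fun k => ?_) j rfl
  rw [prefLen_append k U W, prefLen_append k U' W', hpref, hUl]

/-! ### Reverse insertion and uniqueness -/

theorem rowIns_injective {R S : List ℕ} {x y b : ℕ} (hR : Incr R) (hS : Incr S)
    (hx : IsReducedWord (R ++ [x])) (hy : IsReducedWord (S ++ [y]))
    (e : rowIns R x = rowIns S y) (bx : rowBump R x = [b]) (by_ : rowBump S y = [b]) :
    R = S ∧ x = y := by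
  induction R generalizing S with
  | nil => simp [rowBump] at bx
  | cons a R ih =>
  cases S with
  | nil => simp [rowBump] at by_
  | cons c S =>
  have small_large : ∀ {a c x y : ℕ} {R S : List ℕ}, Incr (a :: R) → x ≤ a → c < y →
      rowIns (a :: R) x = rowIns (c :: S) y → rowBump (a :: R) x = rowBump (c :: S) y →
      rowBump (a :: R) x = [b] → False := by
    intro a c x y R S hR hxa hcy e e' e''
    rw [rowIns_of_gt hcy] at e
    rw [rowBump_of_gt hcy] at e'
    have hyS := mem_rowIns_self S y
    have hby : y < b := by
      rcases rowBump_eq_nil_or (R := S) y with h | ⟨z, h, hz⟩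
      · simp [← e', e''] at h
      · rw [← e', e''] at h
        simp at h; omega
    rcases lt_or_eq_of_le hxa with h | rfl
    · rw [rowBump_of_lt h] at e''
      rw [rowIns_of_lt h] at e
      simp at e e''
      rw [← e.2] at hyS
      have := (List.pairwise_cons.1 hR).1 y hyS
      omega
    · rw [rowBump_of_eq] at e''
      rw [rowIns_of_eq] at e
      simp at e e''
      omega
  have less_eq : ∀ {a c x : ℕ} {R S : List ℕ}, Incr (a :: R) → Incr (c :: S) → x < a →
      IsReducedWord ((c :: S) ++ [c]) → rowIns (a :: R) x = rowIns (c :: S) c →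
      rowBump (a :: R) x = rowBump (c :: S) c → False := by
    intro a c x R S hR hS h hr e e'
    rw [rowIns_of_lt h, rowIns_of_eq] at e
    rw [rowBump_of_lt h, rowBump_of_eq] at e'
    simp at e e'
    have := succ_mem_of_isReducedWord hS hr (by simp)
    simp at this
    rw [← e.2] at this
    have := (List.pairwise_cons.1 hR).1 _ this
    omega
  rcases lt_trichotomy x a with h | h | h <;> rcases lt_trichotomy y c with h' | h' | h'
  · rw [rowIns_of_lt h, rowIns_of_lt h'] at e
    rw [rowBump_of_lt h] at bx
    rw [rowBump_of_lt h'] at by_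
    simp at e bx by_
    simp [e, bx, by_]
  · subst h'
    exact (less_eq hR hS h hy e (by rw [bx, by_])).elim
  · exact (small_large hR h.le h' e (by rw [bx, by_]) bx).elim
  · subst h
    exact (less_eq hS hR h' hx e.symm (by rw [bx, by_])).elim
  · subst h h'
    rw [rowIns_of_eq, rowIns_of_eq] at e
    simp at e
    simp [e]
  · exact (small_large hR h.le h' e (by rw [bx, by_]) bx).elim
  · exact (small_large hS h'.le h e.symm (by rw [bx, by_]) by_).elim
  · exact (small_large hS h'.le h e.symm (by rw [bx, by_]) by_).elim
  · rw [rowIns_of_gt h, rowIns_of_gt h'] at e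
    rw [rowBump_of_gt h] at bx
    rw [rowBump_of_gt h'] at by_
    simp only [List.cons.injEq] at e
    have := ih (List.pairwise_cons.1 hR).2 (List.pairwise_cons.1 hS).2
      (IsReducedWord.right (a := [a]) hx) (IsReducedWord.right (a := [c]) hy) e.2 bx by_
    simp [this, e.1]

theorem ckEquiv_of_append_singleton {ρ σ : List ℕ} {x y : ℕ}
    (h : CKEquiv (ρ ++ [x]) (σ ++ [y])) (hr : IsReducedWord (ρ ++ [x]))
    (hl : ∀ j, rowLen j ρ = rowLen j σ) : CKEquiv ρ σ ∧ x = y := by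
  induction hn : ρ.length using Nat.strong_induction_on generalizing ρ σ x y with
  | _ n ih =>
  subst hn
  have hr' := h.isReducedWord hr
  have e1 := h.rowOf_eq hr
  have e2 := h.restOf hr
  rw [rowOf_append, rowOf_append, insW_cons, insW_cons, insW_nil, insW_nil] at e1
  have er := hr.restOf
  rw [restOf_append] at e2 er
  rw [restOf_append] at e2
  rw [bumpW_cons, bumpW_nil, List.append_nil] at e2 er
  rw [bumpW_cons, bumpW_nil, List.append_nil] at e2
  have l1 := length_rowIns_add (rowOf ρ) x
  have l2 := length_rowIns_add (rowOf σ) y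
  have l0 : (rowOf ρ).length = (rowOf σ).length := hl 0
  rw [e1] at l1
  have c1 := ckEquiv_restOf_rowOf hr.left
  have c2 := ckEquiv_restOf_rowOf hr'.left
  have finish : CKEquiv (restOf ρ) (restOf σ) → rowOf ρ = rowOf σ → CKEquiv ρ σ := by
    intro p q
    rw [q] at c1
    exact c1.trans ((p.append_right _).trans c2.symm)
  rcases rowBump_eq_nil_or (R := rowOf ρ) x with b1 | ⟨b, b1, -⟩ <;>
    rcases rowBump_eq_nil_or (R := rowOf σ) y with b2 | ⟨b', b2, -⟩
  · rw [rowIns_eq_append_of_rowBump_eq_nil b1, rowIns_eq_append_of_rowBump_eq_nil b2] at e1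
    rw [b1, b2, List.append_nil, List.append_nil] at e2
    obtain ⟨p, q⟩ := List.append_inj' e1 rfl
    exact ⟨finish e2 p, by simpa using q⟩
  · simp [b1, b2] at l1 l2; omega
  · simp [b1, b2] at l1 l2; omega
  · rw [b1] at er
    rw [b1, b2] at e2
    have hne : ρ ≠ [] := by
      rintro rfl
      simp [rowOf, rowBump] at b1
    obtain ⟨p, rfl⟩ := ih _ (length_restOf_lt hne) e2 er (fun j => hl (j + 1)) rfl
    have r1 : IsReducedWord (rowOf ρ ++ [x]) :=
      IsReducedWord.right (a := restOf ρ) (by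
        simpa using (c1.append_right [x]).isReducedWord hr)
    have r2 : IsReducedWord (rowOf σ ++ [y]) :=
      IsReducedWord.right (a := restOf σ) (by
        simpa using (c2.append_right [y]).isReducedWord hr')
    obtain ⟨q1, q2⟩ := rowIns_injective (incr_rowOf ρ) (incr_rowOf σ) r1 r2 e1 b1 b2
    exact ⟨finish p q1, q2⟩

theorem MaxPrefixes.eq_of_ckEquiv {σ τ : List ℕ} (hσ : MaxPrefixes σ) (hτ : MaxPrefixes τ)
    (hr : IsReducedWord σ) (h : CKEquiv σ τ) (hpref : ∀ k, prefLen k σ = prefLen k τ) :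
    σ = τ := by
  induction σ using List.reverseRecOn generalizing τ with
  | nil => exact (List.length_eq_zero_iff.1 (by simpa using h.length_eq.symm)).symm
  | append_singleton s x ih =>
    rcases List.eq_nil_or_concat τ with rfl | ⟨t, y, rfl⟩
    · simpa using h.length_eq
    rw [List.concat_eq_append] at *
    have hr' := h.isReducedWord hr
    have hl : s.length = t.length := by simpa using h.length_eq
    have hp : ∀ k, prefLen k s = prefLen k t := fun k => by
      rw [prefLen_append k s [x], prefLen_append k t [y], hpref, hl]
    obtain ⟨p, q⟩ := ckEquiv_of_append_singleton h hr
      (hσ.left.rowLen_eq hτ.left hr.left hr'.left hl hp)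
    rw [ih hσ.left hτ.left hr.left p hp, q]

/-! ### Weak descent tableaux as lists of rows -/

/-- The rows of the weak descent tableau of a word, paired with their indices. -/
def rowBlocks (σ : List ℕ) : List (ℤ × List ℕ) := (wdtRows (runFact σ)).zip (runFact σ)

/-- The tableau with the given rows. -/
def tabOf (P : List (ℤ × List ℕ)) : Tableau := fun r c =>
  if c = 0 then 0
  else
    match P.find? (fun p => decide (p.1 = r)) with
    | some p => p.2.getD (c - 1) 0
    | none => 0

theorem weakDesTab_eq (σ : List ℕ) : weakDesTab σ = tabOf (rowBlocks σ) := rfl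

theorem tabOf_nil (r : ℤ) (c : ℕ) : tabOf [] r c = 0 := by simp [tabOf]

theorem tabOf_cons (p : ℤ × List ℕ) (P : List (ℤ × List ℕ)) (r : ℤ) (c : ℕ) :
    tabOf (p :: P) r c =
      if c = 0 then 0 else if p.1 = r then p.2.getD (c - 1) 0 else tabOf P r c := by
  unfold tabOf
  by_cases hc : c = 0
  · simp [hc]
  · by_cases h : p.1 = r <;> simp [hc, h]

/-- The number of boxes in the rows with index larger than `k`. -/
def highLen (k : ℤ) (P : List (ℤ × List ℕ)) : ℕ :=
  (P.map fun p => if k < p.1 then p.2.length else 0).sum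

/-- The number of boxes in the rows with index `r`. -/
def lenAt (r : ℤ) (P : List (ℤ × List ℕ)) : ℕ :=
  (P.map fun p => if p.1 = r then p.2.length else 0).sum

theorem ncard_getD {b : List ℕ} (hb : PosWord b) :
    Set.ncard {c : ℕ | (if c = 0 then 0 else b.getD (c - 1) 0) ≠ 0} = b.length := by
  have : {c : ℕ | (if c = 0 then 0 else b.getD (c - 1) 0) ≠ 0} =
      (Finset.Icc 1 b.length : Set ℕ) := by
    ext c
    simp only [Set.mem_ofPred_eq, Finset.coe_Icc, Set.mem_Icc]
    by_cases hc : c = 0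
    · simp [hc]
    · rw [if_neg hc]
      by_cases h : c - 1 < b.length
      · have := hb _ (List.getElem_mem h)
        rw [List.getD_eq_getElem _ _ h]
        omega
      · rw [List.getD_eq_default _ _ (by omega)]
        omega
  rw [this, Set.ncard_coe_finset]
  simp

theorem shapeOf_tabOf {P : List (ℤ × List ℕ)} (hP : P.Pairwise fun p q => q.1 < p.1)
    (hpos : ∀ p ∈ P, PosWord p.2) (i : ℕ) : shapeOf (tabOf P) i = lenAt i P := by
  induction P with
  | nil => simp [shapeOf, tabOf_nil, lenAt]
  | cons p P ih =>
    obtain ⟨h1, h2⟩ := List.pairwise_cons.1 hP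
    have ih' := ih h2 fun q hq => hpos q (by simp [hq])
    unfold shapeOf at ih' ⊢
    simp only [tabOf_cons]
    by_cases h : p.1 = i
    · simp only [if_pos h]
      rw [ncard_getD (hpos p (by simp))]
      have : lenAt i P = 0 := by
        unfold lenAt
        rw [List.sum_eq_zero]
        intro x hx
        obtain ⟨q, hq, rfl⟩ := List.mem_map.1 hx
        have := h1 q hq
        exact if_neg (by omega)
      unfold lenAt at this ⊢
      simp [h, this]
    · simp only [if_neg h]
      have e : {c : ℕ | (if c = 0 then 0 else tabOf P i c) ≠ 0} = {c | tabOf P i c ≠ 0} := by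
        ext c
        by_cases hc : c = 0 <;> simp [hc, tabOf]
      rw [e, ih']
      simp [lenAt, h]

theorem sum_lenAt_add_highLen {P : List (ℤ × List ℕ)} (h1 : ∀ p ∈ P, 1 ≤ p.1) (k : ℕ) :
    ∑ i ∈ Finset.Icc 1 k, lenAt (i : ℤ) P + highLen k P = (P.map Prod.snd).flatten.length := by
  induction P with
  | nil => simp [lenAt, highLen]
  | cons p P ih =>
    have ih' := ih fun q hq => h1 q (by simp [hq])
    have hp := h1 p (by simp)
    obtain ⟨m, hm⟩ := Int.eq_ofNat_of_zero_le (by omega : 0 ≤ p.1)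
    have e : ∑ i ∈ Finset.Icc 1 k, (if p.1 = (i : ℤ) then p.2.length else 0) =
        if p.1 ≤ k then p.2.length else 0 := by
      rw [hm]
      simp only [Nat.cast_inj, Finset.sum_ite_eq, Finset.mem_Icc, Nat.cast_le]
      simp only [show 1 ≤ m by omega, true_and]
    simp only [lenAt, highLen, List.map_cons, List.sum_cons, Finset.sum_add_distrib,
      List.flatten_cons, List.length_append] at ih' ⊢
    rw [e]
    split_ifs <;> omega

theorem highLen_le_length (k : ℤ) (P : List (ℤ × List ℕ)) :
    highLen k P ≤ (P.map Prod.snd).flatten.length := by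
  induction P with
  | nil => simp [highLen]
  | cons p P ih =>
    simp only [highLen, List.map_cons, List.sum_cons, List.flatten_cons,
      List.length_append] at ih ⊢
    split_ifs <;> omega

theorem highLen_eq_length {k : ℤ} {P : List (ℤ × List ℕ)} (h : ∀ p ∈ P, k < p.1) :
    highLen k P = (P.map Prod.snd).flatten.length := by
  induction P with
  | nil => simp [highLen]
  | cons p P ih =>
    have := ih fun q hq => h q (by simp [hq])
    simp only [highLen, List.map_cons, List.sum_cons, List.flatten_cons,
      List.length_append, if_pos (h p (by simp))] at this ⊢
    omega

theorem lt_of_length_le_highLen {k : ℤ} {P : List (ℤ × List ℕ)} (hne : ∀ p ∈ P, p.2 ≠ [])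
    (h : (P.map Prod.snd).flatten.length ≤ highLen k P) : ∀ p ∈ P, k < p.1 := by
  induction P with
  | nil => simp
  | cons p P ih =>
    have h1 := highLen_le_length k P
    have h2 := List.length_pos_of_ne_nil (hne p (by simp))
    simp only [highLen, List.map_cons, List.sum_cons, List.flatten_cons,
      List.length_append] at ih h h1 ⊢
    intro q hq
    rcases List.mem_cons.1 hq with rfl | hq
    · by_contra hlt
      rw [if_neg hlt] at h
      omega
    · refine ih (fun q hq => hne q (by simp [hq])) ?_ q hq
      split_ifs at h <;> omega

theorem exists_prefix_of_highLen {P : List (ℤ × List ℕ)} (hP : P.Pairwise fun p q => q.1 < p.1)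
    (hle : ∀ p ∈ P, ∀ x ∈ p.2, p.1 ≤ (x : ℤ)) (k : ℕ) :
    ∃ u v, (P.map Prod.snd).flatten = u ++ v ∧ (∀ x ∈ u, k < x) ∧ u.length = highLen k P := by
  induction P with
  | nil => exact ⟨[], [], by simp [highLen]⟩
  | cons p P ih =>
    obtain ⟨h1, h2⟩ := List.pairwise_cons.1 hP
    by_cases hp : (k : ℤ) < p.1
    · obtain ⟨u, v, e, hu, hl⟩ := ih h2 fun q hq => hle q (by simp [hq])
      refine ⟨p.2 ++ u, v, by simp [e], fun x hx => ?_, ?_⟩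
      · rcases List.mem_append.1 hx with hx | hx
        · have := hle p (by simp) x hx
          omega
        · exact hu x hx
      · simp only [highLen, List.map_cons, List.sum_cons, if_pos hp, List.length_append] at hl ⊢
        omega
    · refine ⟨[], _, rfl, by simp, ?_⟩
      unfold highLen
      rw [List.sum_eq_zero]
      · rfl
      · intro x hx
        obtain ⟨q, hq, rfl⟩ := List.mem_map.1 hx
        refine if_neg ?_
        rcases List.mem_cons.1 hq with rfl | hq
        · exact hp
        · have := h1 q hq
          omega

/-- Shifting rows up by `N` while adding `N` to every entry. -/
def shiftRow (N : ℕ) (p : ℤ × List ℕ) : ℤ × List ℕ := (p.1 + N, p.2.map (· + N))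

theorem highLen_map_shiftRow (N : ℕ) (k : ℤ) (P : List (ℤ × List ℕ)) :
    highLen k (P.map (shiftRow N)) = highLen (k - N) P := by
  unfold highLen
  rw [List.map_map]
  congr 1
  refine List.map_congr_left fun p _ => ?_
  simp only [Function.comp, shiftRow, List.length_map]
  split_ifs <;> omega

theorem tabOf_map_shiftRow (N : ℕ) {P : List (ℤ × List ℕ)} (hpos : ∀ p ∈ P, PosWord p.2)
    (r : ℤ) (c : ℕ) : tabOf (P.map (shiftRow N)) r c =
      if tabOf P (r - N) c = 0 then 0 else tabOf P (r - N) c + N := by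
  induction P with
  | nil => simp [tabOf_nil]
  | cons p P ih =>
    rw [List.map_cons, tabOf_cons, tabOf_cons, ih fun q hq => hpos q (by simp [hq])]
    by_cases hc : c = 0
    · simp [hc]
    · by_cases h : p.1 = r - N
      · rw [if_neg hc, if_neg hc, if_pos h, if_pos (by simp only [shiftRow]; omega)]
        by_cases hl : c - 1 < p.2.length
        · have := hpos p (by simp) _ (List.getElem_mem hl)
          rw [List.getD_eq_getElem _ _ hl, if_neg (by omega)]
          simp [shiftRow, List.getD, hl]
        · rw [List.getD_eq_default _ _ (by simpa [shiftRow] using hl),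
            List.getD_eq_default _ _ (by simpa using hl)]
          simp
      · rw [if_neg hc, if_neg hc, if_neg h, if_neg (by simp only [shiftRow]; omega)]

/-! ### Run factorizations -/

theorem flatten_runFact (σ : List ℕ) : (runFact σ).flatten = σ := by
  induction σ with
  | nil => simp [runFact]
  | cons a σ ih =>
    rw [runFact]
    cases h : runFact σ with
    | nil => rw [h] at ih; simp at ih; simp [← ih]
    | cons r rs =>
      rw [h] at ih
      dsimp only
      split_ifs <;> simp [← ih]

theorem ne_nil_of_mem_runFact {σ b : List ℕ} (h : b ∈ runFact σ) : b ≠ [] := by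
  induction σ generalizing b with
  | nil => simp [runFact] at h
  | cons a σ ih =>
    rw [runFact] at h
    cases hr : runFact σ with
    | nil => rw [hr] at h; simp at h; simp [h]
    | cons r rs =>
      rw [hr] at h ih
      dsimp only at h
      split_ifs at h
      · rcases List.mem_cons.1 h with rfl | h
        · simp
        · exact ih (by simp [h])
      · rcases List.mem_cons.1 h with rfl | h
        · simp
        · exact ih h

theorem headI_le_of_mem_runFact {σ b : List ℕ} (h : b ∈ runFact σ) : ∀ x ∈ b, b.headI ≤ x := by
  induction σ generalizing b with
  | nil => simp [runFact] at h
  | cons a σ ih =>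
    rw [runFact] at h
    cases hr : runFact σ with
    | nil => rw [hr] at h; simp at h; simp [h]
    | cons r rs =>
      rw [hr] at h ih
      dsimp only at h
      split_ifs at h with har
      · rcases List.mem_cons.1 h with rfl | h
        · intro x hx
          rcases List.mem_cons.1 hx with rfl | hx
          · simp
          · exact har.le.trans (ih (by simp) x hx)
        · exact ih (by simp [h])
      · rcases List.mem_cons.1 h with rfl | h
        · simp
        · exact ih h

theorem headI_map_add {b : List ℕ} (hb : b ≠ []) (N : ℕ) :
    (b.map (· + N)).headI = b.headI + N := by
  cases b with
  | nil => exact (hb rfl).elim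
  | cons a b => rfl

theorem runFact_map_add (N : ℕ) (σ : List ℕ) :
    runFact (σ.map (· + N)) = (runFact σ).map (List.map (· + N)) := by
  induction σ with
  | nil => simp [runFact]
  | cons a σ ih =>
    rw [List.map_cons, runFact, ih, runFact]
    have hne : ∀ b ∈ runFact σ, b ≠ [] := fun b => ne_nil_of_mem_runFact
    cases h : runFact σ with
    | nil => simp
    | cons r rs =>
      rw [h] at hne
      simp only [List.map_cons]
      rw [headI_map_add (hne r (by simp))]
      by_cases har : a < r.headI
      · rw [if_pos har, if_pos (by omega)]; simp
      · rw [if_neg har, if_neg (by omega)]; simp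

theorem wdtRowsAux_map_add (N : ℕ) (prev : ℤ) {L : List (List ℕ)} (hL : ∀ b ∈ L, b ≠ []) :
    wdtRowsAux (prev + N) (L.map (List.map (· + N))) = (wdtRowsAux prev L).map (· + (N : ℤ)) := by
  induction L generalizing prev with
  | nil => simp [wdtRowsAux]
  | cons b L ih =>
    have e : min (prev + N - 1) (((b.map (· + N)).headI : ℕ) : ℤ) =
        min (prev - 1) (b.headI : ℤ) + N := by
      rw [headI_map_add (hL b (by simp))]
      push_cast
      omega
    simp only [List.map_cons, wdtRowsAux]
    rw [e, ih _ fun b hb => hL b (by simp [hb])]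

theorem rowBlocks_map_add (N : ℕ) (σ : List ℕ) :
    rowBlocks (σ.map (· + N)) = (rowBlocks σ).map (shiftRow N) := by
  have hne : ∀ b ∈ runFact σ, b ≠ [] := fun b => ne_nil_of_mem_runFact
  have e : wdtRows ((runFact σ).map (List.map (· + N))) =
      (wdtRows (runFact σ)).map (· + (N : ℤ)) := by
    cases h : runFact σ with
    | nil => simp [wdtRows]
    | cons b L =>
      rw [h] at hne
      simp only [List.map_cons, wdtRows]
      rw [headI_map_add (hne b (by simp)), Nat.cast_add,
        wdtRowsAux_map_add N _ fun b hb => hne b (by simp [hb])]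
  unfold rowBlocks
  rw [runFact_map_add, e, List.zip_map]
  rfl

theorem length_wdtRowsAux (prev : ℤ) (L : List (List ℕ)) :
    (wdtRowsAux prev L).length = L.length := by
  induction L generalizing prev with
  | nil => simp [wdtRowsAux]
  | cons b L ih => simp [wdtRowsAux, ih]

theorem length_wdtRows (L : List (List ℕ)) : (wdtRows L).length = L.length := by
  cases L <;> simp [wdtRows, length_wdtRowsAux]

theorem map_fst_rowBlocks (σ : List ℕ) : (rowBlocks σ).map Prod.fst = wdtRows (runFact σ) :=
  List.map_fst_zip (length_wdtRows _).le

theorem map_snd_rowBlocks (σ : List ℕ) : (rowBlocks σ).map Prod.snd = runFact σ :=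
  List.map_snd_zip (length_wdtRows _).ge

theorem wdtRowsAux_lt_and_le (prev : ℤ) (L : List (List ℕ)) :
    (∀ r ∈ wdtRowsAux prev L, r < prev) ∧ (wdtRowsAux prev L).Pairwise (· > ·) ∧
      ∀ p ∈ (wdtRowsAux prev L).zip L, p.1 ≤ (p.2.headI : ℤ) := by
  induction L generalizing prev with
  | nil => simp [wdtRowsAux]
  | cons b L ih =>
    obtain ⟨h1, h2, h3⟩ := ih (min (prev - 1) (b.headI : ℤ))
    simp only [wdtRowsAux, List.zip_cons_cons, List.mem_cons, List.pairwise_cons]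
    refine ⟨?_, ⟨h1, h2⟩, ?_⟩
    · rintro r (rfl | hr)
      · omega
      · have := h1 r hr
        omega
    · rintro p (rfl | hp)
      · exact min_le_right _ _
      · exact h3 p hp

theorem rowBlocks_pairwise (σ : List ℕ) :
    (rowBlocks σ).Pairwise fun p q => q.1 < p.1 := by
  rw [← List.pairwise_map (f := Prod.fst) (R := fun a b => b < a), map_fst_rowBlocks]
  cases runFact σ with
  | nil => simp [wdtRows]
  | cons b L =>
    obtain ⟨h1, h2, -⟩ := wdtRowsAux_lt_and_le b.headI L
    exact List.pairwise_cons.2 ⟨h1, h2⟩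

theorem fst_le_of_mem_rowBlocks {σ : List ℕ} {p : ℤ × List ℕ} (h : p ∈ rowBlocks σ) :
    ∀ x ∈ p.2, p.1 ≤ (x : ℤ) := by
  have hm : p.2 ∈ runFact σ := by
    rw [← map_snd_rowBlocks]
    exact List.mem_map_of_mem h
  have h1 : p.1 ≤ (p.2.headI : ℤ) := by
    unfold rowBlocks at h
    cases hr : runFact σ with
    | nil => simp [hr, wdtRows] at h
    | cons b L =>
      rw [hr] at h
      simp only [wdtRows, List.zip_cons_cons, List.mem_cons] at h
      rcases h with rfl | h
      · exact le_rfl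
      · exact (wdtRowsAux_lt_and_le _ L).2.2 p h
  intro x hx
  exact h1.trans (by exact_mod_cast headI_le_of_mem_runFact hm x hx)

theorem posWord_of_mem_rowBlocks {σ : List ℕ} (hσ : PosWord σ) {p : ℤ × List ℕ}
    (h : p ∈ rowBlocks σ) : PosWord p.2 := by
  intro x hx
  refine hσ x ?_
  rw [← flatten_runFact σ, ← map_snd_rowBlocks]
  exact List.mem_flatten.2 ⟨_, List.mem_map_of_mem h, hx⟩

theorem nonVirtual_iff (σ : List ℕ) : NonVirtual σ ↔ ∀ p ∈ rowBlocks σ, 0 < p.1 := by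
  unfold NonVirtual
  rw [← map_fst_rowBlocks]
  constructor
  · intro h p hp
    exact h _ (List.mem_map_of_mem hp)
  · intro h r hr
    obtain ⟨p, hp, rfl⟩ := List.mem_map.1 hr
    exact h p hp

theorem sum_desComp_add_highLen {σ : List ℕ} (hσ : PosWord σ) (hv : NonVirtual σ) (k : ℕ) :
    ∑ i ∈ Finset.Icc 1 k, desComp σ i + highLen k (rowBlocks σ) = σ.length := by
  have := sum_lenAt_add_highLen ((nonVirtual_iff σ).1 hv) k
  rw [map_snd_rowBlocks, flatten_runFact] at this
  rw [← this]
  congr 1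
  refine Finset.sum_congr rfl fun i _ => ?_
  exact shapeOf_tabOf (rowBlocks_pairwise σ) (fun p => posWord_of_mem_rowBlocks hσ) i

/-! ### Words whose runs have decreasing first letters -/

/-- A list of nonempty increasing blocks whose first letters strictly decrease. -/
def HeadDecr (L : List (List ℕ)) : Prop :=
  (∀ b ∈ L, b ≠ [] ∧ Incr b) ∧ L.Pairwise fun b c => c.headI < b.headI

theorem runFact_append {b w : List ℕ} (hb : b ≠ []) (hi : Incr b)
    (h : ∀ r ∈ (runFact w).head?, r.headI ≤ b.headI) : runFact (b ++ w) = b :: runFact w := by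
  induction b with
  | nil => exact (hb rfl).elim
  | cons a b ih =>
    rw [List.cons_append, runFact]
    cases b with
    | nil =>
      rw [List.nil_append]
      cases hr : runFact w with
      | nil => rfl
      | cons r rs =>
        rw [hr] at h
        have := h r (by simp)
        exact if_neg (not_lt.2 this)
    | cons b0 b =>
      obtain ⟨h1, h2⟩ := List.pairwise_cons.1 hi
      have hab : a < b0 := h1 b0 (by simp)
      rw [ih (by simp) h2 fun r hr => (h r hr).trans hab.le]
      exact if_pos hab

theorem HeadDecr.runFact_flatten {L : List (List ℕ)} (h : HeadDecr L) :
    runFact L.flatten = L := by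
  induction L with
  | nil => simp [runFact]
  | cons b L ih =>
    obtain ⟨h1, h2⟩ := List.pairwise_cons.1 h.2
    have ih' := ih ⟨fun c hc => h.1 c (by simp [hc]), h2⟩
    have hb := h.1 b (by simp)
    rw [List.flatten_cons, runFact_append hb.1 hb.2, ih']
    intro r hr
    rw [ih'] at hr
    exact (h1 r (List.mem_of_mem_head? hr)).le

theorem wdtRowsAux_eq_map {prev : ℤ} {L : List (List ℕ)} (h : ∀ b ∈ L, (b.headI : ℤ) < prev)
    (hL : L.Pairwise fun b c => c.headI < b.headI) :
    wdtRowsAux prev L = L.map fun b => (b.headI : ℤ) := by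
  induction L generalizing prev with
  | nil => simp [wdtRowsAux]
  | cons b L ih =>
    obtain ⟨h1, h2⟩ := List.pairwise_cons.1 hL
    have := h b (by simp)
    have e : min (prev - 1) (b.headI : ℤ) = b.headI := by omega
    rw [wdtRowsAux, e, ih (fun c hc => by exact_mod_cast h1 c hc) h2, List.map_cons]

theorem HeadDecr.rowBlocks_flatten {L : List (List ℕ)} (h : HeadDecr L) :
    rowBlocks L.flatten = L.map fun b => ((b.headI : ℤ), b) := by
  have e : wdtRows L = L.map fun b => (b.headI : ℤ) := by
    cases L with
    | nil => rfl
    | cons b L =>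
      obtain ⟨h1, h2⟩ := List.pairwise_cons.1 h.2
      rw [wdtRows, wdtRowsAux_eq_map (fun c hc => by exact_mod_cast h1 c hc) h2, List.map_cons]
  rw [rowBlocks, h.runFact_flatten, e, List.zip_eq_zipWith, List.zipWith_map_left,
    List.zipWith_self]

theorem headI_mem {b : List ℕ} (hb : b ≠ []) : b.headI ∈ b := by
  cases b with
  | nil => exact (hb rfl).elim
  | cons a b => simp

theorem LeftDom.headI_lt {A W : List ℕ} (h : LeftDom A W) (hA : A ≠ []) :
    W.headI < A.headI := by
  cases A with
  | nil => exact (hA rfl).elim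
  | cons a A =>
    cases W with
    | nil => simp at h
    | cons w W => exact ((leftDom_cons_cons _ _ _ _).1 h).1

theorem exists_headDecr {ρ : List ℕ} (hr : IsReducedWord ρ) :
    ∃ L, HeadDecr L ∧ CKEquiv ρ L.flatten ∧ ∀ b ∈ L, (rowOf ρ).headI ≤ b.headI := by
  induction hn : ρ.length using Nat.strong_induction_on generalizing ρ with
  | _ n ih =>
  subst hn
  by_cases hne : ρ = []
  · subst hne
    exact ⟨[], ⟨by simp, List.Pairwise.nil⟩, CKEquiv.refl _, by simp⟩
  obtain ⟨L, h1, h2, h3⟩ := ih _ (length_restOf_lt hne) hr.restOf rfl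
  have hlt : ∀ b ∈ L, (rowOf ρ).headI < b.headI := by
    intro b hb
    have hrest : restOf ρ ≠ [] := by
      intro e
      rw [e] at h2
      have := List.length_eq_zero_iff.1 h2.length_eq.symm
      exact (h1.1 b hb).1 (List.flatten_eq_nil_iff.1 this b hb)
    exact ((leftDom_rowOf_restOf hr).headI_lt (rowOf_ne_nil hrest)).trans_le (h3 b hb)
  refine ⟨L ++ [rowOf ρ], ⟨?_, ?_⟩, ?_, ?_⟩
  · intro b hb
    rcases List.mem_append.1 hb with hb | hb
    · exact h1.1 b hb
    · rw [List.mem_singleton.1 hb]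
      exact ⟨rowOf_ne_nil hne, incr_rowOf ρ⟩
  · rw [List.pairwise_append]
    refine ⟨h1.2, List.pairwise_singleton _ _, fun b hb c hc => ?_⟩
    rw [List.mem_singleton.1 hc]
    exact hlt b hb
  · refine (ckEquiv_restOf_rowOf hr).trans ((h2.append_right _).trans (CKEquiv.of_eq ?_))
    simp
  · intro b hb
    rcases List.mem_append.1 hb with hb | hb
    · exact (hlt b hb).le
    · rw [List.mem_singleton.1 hb]

theorem exists_nonVirtual_of_forall_lt {σ u v : List ℕ} {k : ℕ} (hr : IsReducedWord σ)
    (h : CKEquiv σ (u ++ v)) (hu : ∀ x ∈ u, k < x) :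
    ∃ τ, NonVirtual τ ∧ CKEquiv σ τ ∧ u.length ≤ highLen k (rowBlocks τ) := by
  induction hn : v.length using Nat.strong_induction_on generalizing u v with
  | _ n ih =>
  subst hn
  have hr' := h.isReducedWord hr
  obtain ⟨L, hL, hL', -⟩ := exists_headDecr hr'.left
  obtain ⟨M, hM, hM', -⟩ := exists_headDecr hr'.right
  by_cases hk : ∀ b ∈ M, b.headI ≤ k
  · have hLk : ∀ b ∈ L, k < b.headI := fun b hb => by
      refine hu _ ((hL'.mem_iff _).2 (List.mem_flatten.2 ⟨b, hb, headI_mem (hL.1 b hb).1⟩))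
    have hLM : HeadDecr (L ++ M) := by
      refine ⟨fun b hb => ?_, List.pairwise_append.2 ⟨hL.2, hM.2, fun b hb c hc =>
        (hk c hc).trans_lt (hLk b hb)⟩⟩
      rcases List.mem_append.1 hb with hb | hb
      · exact hL.1 b hb
      · exact hM.1 b hb
    have hc : CKEquiv σ (L ++ M).flatten := by
      rw [List.flatten_append]
      exact h.trans (hL'.append hM')
    refine ⟨(L ++ M).flatten, ?_, hc, ?_⟩
    · rw [nonVirtual_iff, hLM.rowBlocks_flatten]
      intro p hp
      obtain ⟨b, hb, rfl⟩ := List.mem_map.1 hp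
      have := (hc.isReducedWord hr).1 b.headI
        (List.mem_flatten.2 ⟨b, hb, headI_mem (hLM.1 b hb).1⟩)
      simpa [Nat.pos_iff_ne_zero] using Nat.one_le_iff_ne_zero.1 this
    · rw [hLM.rowBlocks_flatten, hL'.length_eq]
      have e : highLen k (L.map fun b => ((b.headI : ℤ), b)) = L.flatten.length := by
        rw [highLen_eq_length, List.map_map]
        · congr 2
          exact List.map_id _
        · intro p hp
          obtain ⟨b, hb, rfl⟩ := List.mem_map.1 hp
          simpa using hLk b hb
      rw [← e]
      simp [highLen]
  · push Not at hk
    obtain ⟨b, hb, hbk⟩ := hk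
    cases M with
    | nil => simp at hb
    | cons c M =>
      have hck : k < c.headI := by
        rcases List.mem_cons.1 hb with rfl | hb
        · exact hbk
        · exact hbk.trans ((List.pairwise_cons.1 hM.2).1 b hb)
      have hc0 := (hM.1 c (by simp)).1
      cases c with
      | nil => exact (hc0 rfl).elim
      | cons y c =>
        have h1 : CKEquiv σ ((u ++ [y]) ++ (c ++ M.flatten)) := by
          refine h.trans ((hM'.append_left u).trans (CKEquiv.of_eq ?_))
          simp
        have hl := hM'.length_eq
        simp only [List.flatten_cons, List.cons_append, List.length_cons] at hl
        obtain ⟨τ, t1, t2, t3⟩ := ih _ (by omega) h1 (by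
          intro x hx
          rcases List.mem_append.1 hx with hx | hx
          · exact hu x hx
          · rw [List.mem_singleton.1 hx]; exact hck) rfl
        refine ⟨τ, t1, t2, le_trans ?_ t3⟩
        simp

/-! ### Yamanouchi words -/

theorem exists_prefix_of_highLen_rowBlocks (σ : List ℕ) (k : ℕ) :
    ∃ u v, σ = u ++ v ∧ (∀ x ∈ u, k < x) ∧ u.length = highLen k (rowBlocks σ) := by
  have := exists_prefix_of_highLen (rowBlocks_pairwise σ)
    (fun p => fst_le_of_mem_rowBlocks) k
  rwa [map_snd_rowBlocks, flatten_runFact] at this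

theorem yamanouchi_iff {σ : List ℕ} (hr : IsReducedWord σ) :
    Yamanouchi σ ↔ NonVirtual σ ∧ ∀ (k : ℕ) (u v : List ℕ), CKEquiv σ (u ++ v) →
      (∀ x ∈ u, k < x) → u.length ≤ highLen k (rowBlocks σ) := by
  constructor
  · rintro ⟨-, hv, h⟩
    refine ⟨hv, fun k u v he hu => ?_⟩
    obtain ⟨τ, t1, t2, t3⟩ := exists_nonVirtual_of_forall_lt hr he hu
    have h1 := h τ t1 t2 k
    have h2 := sum_desComp_add_highLen hr.1 hv k
    have h3 := sum_desComp_add_highLen (t2.isReducedWord hr).1 t1 k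
    have := t2.length_eq
    omega
  · rintro ⟨hv, h⟩
    refine ⟨hr, hv, fun τ t1 t2 k => ?_⟩
    obtain ⟨u, v, e, hu, hl⟩ := exists_prefix_of_highLen_rowBlocks τ k
    have h1 := h k u v (e ▸ t2) hu
    have h2 := sum_desComp_add_highLen hr.1 hv k
    have h3 := sum_desComp_add_highLen (t2.isReducedWord hr).1 t1 k
    have := t2.length_eq
    omega

theorem Yamanouchi.prefLen_eq {σ : List ℕ} (h : Yamanouchi σ) (k : ℕ) :
    prefLen k σ = highLen k (rowBlocks σ) := by
  apply le_antisymm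
  · refine ((yamanouchi_iff h.1).1 h).2 k _ (σ.dropWhile fun x => decide (k < x))
      (CKEquiv.of_eq (List.takeWhile_append_dropWhile).symm) fun x hx => ?_
    simpa using List.mem_takeWhile_imp hx
  · obtain ⟨u, v, e, hu, hl⟩ := exists_prefix_of_highLen_rowBlocks σ k
    rw [← hl]
    conv_rhs => rw [e, prefLen_append_of_forall_lt hu]
    omega

theorem Yamanouchi.maxPrefixes {σ : List ℕ} (h : Yamanouchi σ) : MaxPrefixes σ := by
  intro k u v he hu
  rw [h.prefLen_eq]
  exact ((yamanouchi_iff h.1).1 h).2 k u v he hu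

theorem MaxPrefixes.prefLen_le {σ τ : List ℕ} (h : MaxPrefixes σ) (he : CKEquiv σ τ) (k : ℕ) :
    prefLen k τ ≤ prefLen k σ := by
  refine h k _ (τ.dropWhile fun x => decide (k < x)) ?_ fun x hx => by
    simpa using List.mem_takeWhile_imp hx
  rwa [List.takeWhile_append_dropWhile]

theorem Yamanouchi.eq_of_ckEquiv {σ τ : List ℕ} (hσ : Yamanouchi σ) (hτ : Yamanouchi τ)
    (h : CKEquiv σ τ) : σ = τ :=
  hσ.maxPrefixes.eq_of_ckEquiv hτ.maxPrefixes hσ.1 h fun k =>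
    le_antisymm (hτ.maxPrefixes.prefLen_le h.symm k) (hσ.maxPrefixes.prefLen_le h k)

theorem length_rowBlocks (σ : List ℕ) : ((rowBlocks σ).map Prod.snd).flatten.length = σ.length := by
  rw [map_snd_rowBlocks, flatten_runFact]

theorem Yamanouchi.map_add {σ : List ℕ} (h : Yamanouchi σ) (N : ℕ) :
    Yamanouchi (σ.map (· + N)) := by
  obtain ⟨hv, hp⟩ := (yamanouchi_iff h.1).1 h
  rw [nonVirtual_iff] at hv
  refine (yamanouchi_iff (h.1.map_add N)).2 ⟨?_, fun k u v he hu => ?_⟩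
  · rw [nonVirtual_iff, rowBlocks_map_add]
    intro p hp
    obtain ⟨q, hq, rfl⟩ := List.mem_map.1 hp
    have := hv q hq
    simp only [shiftRow]
    omega
  · rw [rowBlocks_map_add, highLen_map_shiftRow]
    obtain ⟨w, hw, hσw⟩ := he.exists_of_map_add
    obtain ⟨u', v', rfl, rfl, rfl⟩ := List.append_eq_map_iff.1 hw
    rw [List.length_map]
    rcases le_or_gt N k with hk | hk
    · rw [← Nat.cast_sub hk]
      refine hp _ u' v' hσw fun x hx => ?_
      have := hu (x + N) (List.mem_map.2 ⟨x, hx, rfl⟩)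
      omega
    · rw [highLen_eq_length fun p hp => (by omega : (k : ℤ) - N < 0).trans (hv p hp),
        length_rowBlocks, hσw.length_eq]
      simp

theorem Yamanouchi.of_map_add {σ : List ℕ} {N : ℕ} (hr : IsReducedWord σ)
    (h : Yamanouchi (σ.map (· + N))) : Yamanouchi σ := by
  obtain ⟨-, hp⟩ := (yamanouchi_iff h.1).1 h
  simp only [rowBlocks_map_add, highLen_map_shiftRow] at hp
  refine (yamanouchi_iff hr).2 ⟨?_, fun k u v he hu => ?_⟩
  · rw [nonVirtual_iff]
    have h1 := hp N (σ.map (· + N)) [] (CKEquiv.of_eq (by simp)) (by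
      intro x hx
      obtain ⟨y, hy, rfl⟩ := List.mem_map.1 hx
      have := hr.1 y hy
      omega)
    rw [sub_self, List.length_map, ← length_rowBlocks] at h1
    refine lt_of_length_le_highLen (fun p hp => ?_) h1
    refine ne_nil_of_mem_runFact (σ := σ) ?_
    rw [← map_snd_rowBlocks]
    exact List.mem_map_of_mem hp
  · have h1 := hp (k + N) (u.map (· + N)) (v.map (· + N)) (by simpa using he.map_add N) (by
      intro x hx
      obtain ⟨y, hy, rfl⟩ := List.mem_map.1 hx
      have := hu y hy
      omega)
    rwa [List.length_map, Nat.cast_add, add_sub_cancel_right] at h1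

theorem hatRho_map_add {ρ : List ℕ} (hr : IsReducedWord ρ) (N : ℕ) :
    hatRho (ρ.map (· + N)) = (hatRho ρ).map (· + N) := by
  by_cases h : ∃ σ, Yamanouchi σ ∧ CKEquiv ρ σ
  · have h' : ∃ σ, Yamanouchi σ ∧ CKEquiv (ρ.map (· + N)) σ :=
      ⟨_, h.choose_spec.1.map_add N, h.choose_spec.2.map_add N⟩
    rw [hatRho, hatRho, dif_pos h, dif_pos h']
    exact h'.choose_spec.1.eq_of_ckEquiv (h.choose_spec.1.map_add N)
      (h'.choose_spec.2.symm.trans (h.choose_spec.2.map_add N))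
  · have h' : ¬ ∃ σ, Yamanouchi σ ∧ CKEquiv (ρ.map (· + N)) σ := by
      rintro ⟨τ, h1, h2⟩
      obtain ⟨σ, rfl, h3⟩ := h2.exists_of_map_add
      exact h ⟨σ, h1.of_map_add (h3.isReducedWord hr), h3⟩
    rw [hatRho, hatRho, dif_neg h, dif_neg h', List.map_nil]

theorem posWord_hatRho (ρ : List ℕ) : PosWord (hatRho ρ) := by
  unfold hatRho
  split_ifs with h
  · exact h.choose_spec.1.1.1
  · simp [PosWord]

theorem hatP_map_add {ρ : List ℕ} (hr : IsReducedWord ρ) (N : ℕ) (r : ℤ) (c : ℕ) :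
    hatP (ρ.map (· + N)) r c =
      if hatP ρ (r - N) c = 0 then 0 else hatP ρ (r - N) c + N := by
  unfold hatP
  rw [hatRho_map_add hr, weakDesTab_eq, weakDesTab_eq, rowBlocks_map_add,
    tabOf_map_shiftRow N fun p => posWord_of_mem_rowBlocks (posWord_hatRho ρ)]

/-! ### Shifted factorizations -/

theorem topIdx_shiftFact (N : ℕ) (f : ℕ → List ℕ) : topIdx (shiftFact N f) = topIdx f := by
  simp [topIdx, shiftFact]

theorem factWordGe_eq_flatten (f : ℕ → List ℕ) (i : ℕ) : factWordGe f i =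
    ((((List.range (topIdx f + 1)).reverse).filter (fun j => decide (i ≤ j))).map f).flatten := by
  rw [factWordGe, List.foldr_append_eq_append, List.append_nil]
  simp [Function.comp_def]

theorem factWordGe_shiftFact (N : ℕ) (f : ℕ → List ℕ) (i : ℕ) :
    factWordGe (shiftFact N f) i = (factWordGe f i).map (· + N) := by
  rw [factWordGe_eq_flatten, factWordGe_eq_flatten, topIdx_shiftFact, List.map_flatten,
    List.map_map]
  rfl

theorem filter_reverse_range_prefix_range (n i : ℕ) :
    (List.range n).reverse.filter (fun j => decide (i ≤ j)) <+: (List.range n).reverse := by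
  induction n with
  | zero => simp
  | succ n ih =>
    rw [List.range_succ, List.reverse_append, List.reverse_singleton, List.singleton_append]
    by_cases h : i ≤ n
    · rw [List.filter_cons_of_pos (by simpa using h)]
      exact (List.prefix_cons_inj n).2 ih
    · rw [List.filter_eq_nil_iff.2]
      · exact ⟨_, List.nil_append _⟩
      · intro j hj
        simp at hj ⊢
        omega

theorem exists_factWord_eq_append (f : ℕ → List ℕ) (i : ℕ) :
    ∃ t, factWord f = factWordGe f i ++ t := by
  obtain ⟨t, ht⟩ := filter_reverse_range_prefix_range (topIdx f + 1) i
  refine ⟨(t.map f).flatten, ?_⟩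
  rw [factWord, factWordGe_eq_flatten, factWordGe_eq_flatten, ← List.flatten_append,
    ← List.map_append, ht]
  congr 2
  exact List.filter_eq_self.2 (by simp)

theorem mem_factWord {f : ℕ → List ℕ} (hf : {i | f i ≠ []}.Finite) {i x : ℕ} (hx : x ∈ f i) :
    x ∈ factWord f := by
  rw [factWord, factWordGe_eq_flatten]
  refine List.mem_flatten.2 ⟨f i, List.mem_map_of_mem ?_, hx⟩
  have : i ≤ topIdx f := le_csSup hf.bddAbove (List.ne_nil_of_mem hx)
  simp
  omega

theorem shiftFact_mem_RFCset {w : Equiv.Perm ℕ} {φ : ℕ → ℕ} (hφ : IsFlag φ) {f : ℕ → List ℕ}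
    (hf : f ∈ RFCset w φ) (N : ℕ) :
    shiftFact N f ∈ RFCset (wordPerm ((factWord f).map (· + N))) φ := by
  obtain ⟨h0, hfin, hinc, hflag, hred, -⟩ := hf
  have hne : ∀ i, shiftFact N f i ≠ [] ↔ f i ≠ [] := fun i => by simp [shiftFact]
  have e : factWord (shiftFact N f) = (factWord f).map (· + N) := factWordGe_shiftFact N f 0
  refine ⟨by simp [shiftFact, h0], by simpa only [hne] using hfin, fun i => ?_, fun i hi => ?_,
    ?_, by rw [e]⟩
  · refine (List.isChain_map _).2 ((hinc i).imp fun a b hab => ?_)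
    simpa using hab
  · have hi' := (hne i).1 hi
    have hpos := hred.1 _ (mem_factWord hfin (headI_mem hi'))
    refine (hflag i hi').trans ?_
    rw [shiftFact, headI_map_add hi']
    exact hφ.1 _ _ hpos (Nat.le_add_right _ _)
  · rw [e]
    exact hred.map_add N

theorem hatQfact_shiftFact {f : ℕ → List ℕ} (hf : IsReducedWord (factWord f)) (N : ℕ) (r : ℤ)
    (c : ℕ) : hatQfact (shiftFact N f) r c = hatQfact f (r - N) c := by
  have hred : ∀ i, IsReducedWord (factWordGe f i) := fun i => by
    obtain ⟨t, ht⟩ := exists_factWord_eq_append f i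
    rw [ht] at hf
    exact hf.left
  have hzero : ∀ i, hatP (factWordGe (shiftFact N f) i) r c = 0 ↔
      hatP (factWordGe f i) (r - N) c = 0 := fun i => by
    rw [factWordGe_shiftFact, hatP_map_add (hred i)]
    split_ifs with h
    · simp [h]
    · simp [h]
  unfold hatQfact
  simp only [ne_eq, hzero]

/-- Lemma: behaviour of `P̂` and `Q̂` under `shift_N`.
For `r^• ∈ RFC(w, φ)`, the tableau `P̂(shift_N(r^•))` is obtained from `P̂(r^•)` by shifting
all boxes up by `N` rows and adding `N` to all entries, while `Q̂(shift_N(r^•))` is obtained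
from `Q̂(r^•)` by shifting all boxes up by `N` rows; moreover
`shift_N(r^•) ∈ RFC(1_N × w, φ)`, where `1_N × w` is the permutation fixing `1, …, N` with
`(1_N × w)(i + N) = w(i) + N`. -/
theorem shift_hatP_hatQ (N : ℕ) (hN : 1 ≤ N) (w : Equiv.Perm ℕ) (hw : FinitaryPerm w)
    (φ : ℕ → ℕ) (hφ : IsFlag φ) (f : ℕ → List ℕ) (hf : f ∈ RFCset w φ) :
    (∃ w' : Equiv.Perm ℕ, (∀ i : ℕ, i ≤ N → w' i = i) ∧
      (∀ i : ℕ, w' (i + N) = w i + N) ∧ shiftFact N f ∈ RFCset w' φ) ∧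
    (∀ (r : ℤ) (c : ℕ),
      hatP (factWord (shiftFact N f)) r c =
        (if hatP (factWord f) (r - (N : ℤ)) c = 0 then 0
         else hatP (factWord f) (r - (N : ℤ)) c + N)) ∧
    (∀ (r : ℤ) (c : ℕ),
      hatQfact (shiftFact N f) r c = hatQfact f (r - (N : ℤ)) c) := by
  refine ⟨⟨wordPerm ((factWord f).map (· + N)), fun i hi => ?_, fun i => ?_,
    shiftFact_mem_RFCset hφ hf N⟩, fun r c => ?_, hatQfact_shiftFact hf.2.2.2.2.1 N⟩
  · exact wordPerm_map_add_apply_of_le N hf.2.2.2.2.1.1 hi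
  · rw [wordPerm_map_add_apply, hf.2.2.2.2.2]
  · have e : factWord (shiftFact N f) = (factWord f).map (· + N) := factWordGe_shiftFact N f 0
    rw [e, hatP_map_add hf.2.2.2.2.1]

end
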